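/- arXiv:2303.09021 — 7 statements merged into one kernel-verified Lean document; each statement's English description precedes it below -/
import Mathlib

section
/- Let A(n_1,…,n_p) denote the number of equivalence classes of acyclic orientations of K_{n_1,…,n_p} under part-preserving isomorphism. Then A(n_1,…,n_p) = Σ_{j : n_j ≥ 1} A(n_1,…,n_j − 1,…,n_p) whenever n_1 + … + n_p ≥ 1, and A(0,…,0) = 1. -/
/-- The vertex set of the complete multipartite graph `K_{n 0, …, n (p-1)}`:
part `i` has `n i` vertices, and `Sigma.fst` is the part function. -/
def MPVertex (p : ℕ) (n : Fin p → ℕ) : Type := Σ i : Fin p, Fin (n i)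

/-- An acyclic orientation of the complete multipartite graph `K_{n 0, …, n (p-1)}`:
a relation holding only between vertices of different parts, exactly one direction
for each pair of vertices in different parts, whose transitive closure is
irreflexive. -/
def AcyclicOrientation (p : ℕ) (n : Fin p → ℕ) : Type :=
  { o : MPVertex p n → MPVertex p n → Prop //
      (∀ u v, o u v → u.1 ≠ v.1) ∧
      (∀ u v, u.1 ≠ v.1 → Xor' (o u v) (o v u)) ∧
      Irreflexive (Relation.TransGen o) }

/-- Part-preserving isomorphism of orientations: a bijection of the vertices fixing
the part of every vertex and transporting one orientation to the other. -/
def PartIso {p : ℕ} {n : Fin p → ℕ} (o₁ o₂ : AcyclicOrientation p n) : Prop :=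
  ∃ σ : MPVertex p n ≃ MPVertex p n,
    (∀ v, (σ v).1 = v.1) ∧ ∀ u v, o₂.1 (σ u) (σ v) ↔ o₁.1 u v

/-- `A p n` is the number of equivalence classes of acyclic orientations of
`K_{n 0, …, n (p-1)}` under part-preserving isomorphism. -/
noncomputable def A (p : ℕ) (n : Fin p → ℕ) : ℕ :=
  Nat.card (Quot (@PartIso p n))

instance MPVertex.fintype (p : ℕ) (n : Fin p → ℕ) : Fintype (MPVertex p n) :=
  inferInstanceAs (Fintype (Σ i : Fin p, Fin (n i)))

instance MPVertex.decEq (p : ℕ) (n : Fin p → ℕ) : DecidableEq (MPVertex p n) :=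
  inferInstanceAs (DecidableEq (Σ i : Fin p, Fin (n i)))

/-- The words in which the letter `i` occurs `n i` times. -/
def MPWord (p : ℕ) (n : Fin p → ℕ) : Type :=
  { l : List (Fin p) // ∀ i, l.count i = n i }

/-- The word `l` is the sequence of parts along a linear ordering inducing `o`. -/
def MPRep {p : ℕ} {n : Fin p → ℕ} (o : AcyclicOrientation p n) (l : List (Fin p)) : Prop :=
  ∃ e : MPVertex p n ≃ Fin l.length, (∀ v, l.get (e v) = v.1) ∧
    ∀ u v, o.1 u v ↔ u.1 ≠ v.1 ∧ e u < e v

theorem mp_card_get {p : ℕ} (l : List (Fin p)) (i : Fin p) :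
    (Finset.univ.filter fun k => l.get k = i).card = l.count i :=
  Fin.card_filter_univ_eq_vector_get_eq_count i (⟨l, rfl⟩ : List.Vector (Fin p) l.length)

theorem mp_card_part {p : ℕ} (n : Fin p → ℕ) (i : Fin p) :
    Fintype.card {v : MPVertex p n // v.1 = i} = n i := by
  have := Fintype.card_congr (Equiv.sigmaSubtype (β := fun i => Fin (n i)) i)
  rw [Fintype.card_fin] at this
  rw [← this]
  exact Fintype.card_congr (Equiv.refl _)

theorem mp_count {p : ℕ} {n : Fin p → ℕ} {l : List (Fin p)}
    (e : MPVertex p n ≃ Fin l.length) (he : ∀ v, l.get (e v) = v.1) (i : Fin p) :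
    l.count i = n i := by
  rw [← mp_card_get, ← mp_card_part n i, ← Fintype.card_subtype]
  exact (Fintype.card_congr (e.subtypeEquiv fun v => by rw [he])).symm

theorem mp_exists_equiv {p : ℕ} {n : Fin p → ℕ} {l : List (Fin p)}
    (hl : ∀ i, l.count i = n i) :
    ∃ e : MPVertex p n ≃ Fin l.length, ∀ v, l.get (e v) = v.1 := by
  have h : ∀ i, Nonempty ({v : MPVertex p n // v.1 = i} ≃ {k // l.get k = i}) := fun i => by
    refine ⟨Fintype.equivOfCardEq ?_⟩
    rw [mp_card_part, ← hl i, ← mp_card_get, Fintype.card_subtype]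
  let g := fun i => (h i).some
  refine ⟨Equiv.ofFiberEquiv (f := fun v : MPVertex p n => v.1) (g := l.get) g, fun v => ?_⟩
  exact Equiv.ofFiberEquiv_map g v

theorem mp_exists_rep {p : ℕ} {n : Fin p → ℕ} (o : AcyclicOrientation p n) :
    ∃ l, MPRep o l := by
  obtain ⟨o, h1, h2, h3⟩ := o
  have hso : IsStrictOrder (MPVertex p n) (Relation.TransGen o) :=
    { irrefl := h3, trans := fun _ _ _ => Relation.TransGen.trans }
  letI := partialOrderOfSO (Relation.TransGen o)
  letI : Fintype (LinearExtension (MPVertex p n)) := MPVertex.fintype p n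
  let e' := (Fintype.orderIsoFinOfCardEq (LinearExtension (MPVertex p n)) rfl).symm
  let e : MPVertex p n ≃ Fin (Fintype.card (LinearExtension (MPVertex p n))) := e'.toEquiv
  have hmono : ∀ u v, o u v → e u < e v := by
    intro u v h
    have hle : u ≤ v := Or.inr (Relation.TransGen.single h)
    have hle' := e'.monotone (toLinearExtension.monotone hle)
    refine lt_of_le_of_ne hle' fun h' => h1 u v h ?_
    exact congrArg Sigma.fst (e.injective h')
  refine ⟨List.ofFn fun k => (e.symm k).1,
    e.trans (finCongr (List.length_ofFn).symm), fun v => ?_, fun u v => ?_⟩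
  · simp
  · constructor
    · intro h
      exact ⟨h1 u v h, by simpa using hmono u v h⟩
    · rintro ⟨hne, hlt⟩
      have hlt : e u < e v := by simpa using hlt
      rcases h2 u v hne with h | h
      · exact h.1
      · exact absurd (hmono _ _ h.1) hlt.asymm

theorem mp_exists_of_word {p : ℕ} {n : Fin p → ℕ} {l : List (Fin p)}
    (hl : ∀ i, l.count i = n i) : ∃ o : AcyclicOrientation p n, MPRep o l := by
  obtain ⟨e, he⟩ := mp_exists_equiv hl
  refine ⟨⟨fun u v => u.1 ≠ v.1 ∧ e u < e v, fun u v h => h.1, fun u v h => ?_, ?_⟩,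
    e, he, fun u v => Iff.rfl⟩
  · have hne : e u ≠ e v := fun h' => h (by rw [e.injective h'])
    rcases lt_or_gt_of_ne hne with h' | h'
    · exact Or.inl ⟨⟨h, h'⟩, fun h'' => h''.2.asymm h'⟩
    · exact Or.inr ⟨⟨h.symm, h'⟩, fun h'' => h''.2.asymm h'⟩
  · intro v hv
    have : ∀ u v, Relation.TransGen (fun u v : MPVertex p n => u.1 ≠ v.1 ∧ e u < e v) u v →
        e u < e v := by
      intro u v h
      induction h with
      | single h => exact h.2
      | tail _ h ih => exact ih.trans h.2
    exact lt_irrefl _ (this v v hv)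

theorem mp_iso_of_rep {p : ℕ} {n : Fin p → ℕ} {o o' : AcyclicOrientation p n}
    {l : List (Fin p)} (h : MPRep o l) (h' : MPRep o' l) : PartIso o o' := by
  obtain ⟨e, he, ho⟩ := h
  obtain ⟨e', he', ho'⟩ := h'
  have hp : ∀ v, ((e.trans e'.symm) v).1 = v.1 := fun v => by
    rw [← he', ← he]; simp
  refine ⟨e.trans e'.symm, hp, fun u v => ?_⟩
  rw [ho, ho', hp, hp]
  simp

theorem mp_rep_of_iso {p : ℕ} {n : Fin p → ℕ} {o o' : AcyclicOrientation p n}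
    {l : List (Fin p)} (h : MPRep o l) (h' : PartIso o o') : MPRep o' l := by
  obtain ⟨e, he, ho⟩ := h
  obtain ⟨σ, hσ, hoo⟩ := h'
  have hp : ∀ v, (σ.symm v).1 = v.1 := fun v => by
    rw [← hσ]; simp
  refine ⟨σ.symm.trans e, fun v => ?_, fun u v => ?_⟩
  · simpa [hp] using he (σ.symm v)
  · have := hoo (σ.symm u) (σ.symm v)
    simp only [Equiv.apply_symm_apply] at this
    rw [this, ho, hp, hp]; rfl

/-- The key step: two orderings inducing the same orientation cannot first differ at `k`
with the vertex at `k` in the first preceding the one at `k` in the second. -/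
theorem mp_key {V P : Type*} {N : ℕ} (f : V → P) (e₁ e₂ : V ≃ Fin N)
    (ho : ∀ u v, f u ≠ f v → (e₁ u < e₁ v ↔ e₂ u < e₂ v)) (k : Fin N)
    (hk : ∀ m < k, f (e₁.symm m) = f (e₂.symm m))
    (hne : f (e₁.symm k) ≠ f (e₂.symm k)) : ¬ k < e₁ (e₂.symm k) := by
  classical
  intro hlt
  set v := e₂.symm k with hv
  let S₂ := Finset.univ.filter fun m : Fin N => f (e₂.symm m) ≠ f v ∧ m < k
  let S₁ := Finset.univ.filter fun m : Fin N => f (e₁.symm m) ≠ f v ∧ m < e₁ v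
  have hcard : S₁.card = S₂.card := by
    refine Finset.card_equiv (e₁.symm.trans e₂) fun m => ?_
    simp only [S₁, S₂, Finset.mem_filter, Finset.mem_univ, true_and, Equiv.trans_apply,
      Equiv.symm_apply_apply]
    refine and_congr_right fun h => ?_
    have := ho _ _ h
    simpa [hv] using this
  have hss : S₂ ⊂ S₁ := by
    refine Finset.ssubset_iff_subset_ne.2 ⟨fun m hm => ?_, fun h => ?_⟩
    · simp only [S₁, S₂, Finset.mem_filter, Finset.mem_univ, true_and] at hm ⊢
      exact ⟨by rw [hk m hm.2]; exact hm.1, hm.2.trans hlt⟩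
    · have : k ∈ S₂ := by
        rw [h]
        simp only [S₁, Finset.mem_filter, Finset.mem_univ, true_and]
        exact ⟨hne, hlt⟩
      simp [S₂] at this
  exact absurd hcard (Finset.card_lt_card hss).ne'

theorem mp_word_eq {V P : Type*} {N : ℕ} (f : V → P) (e₁ e₂ : V ≃ Fin N)
    (ho : ∀ u v, f u ≠ f v → (e₁ u < e₁ v ↔ e₂ u < e₂ v)) (k : Fin N) :
    f (e₁.symm k) = f (e₂.symm k) := by
  induction k using WellFoundedLT.induction with
  | ind k ih =>
    by_contra hne
    have a := mp_key f e₁ e₂ ho k ih hne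
    have b := mp_key f e₂ e₁ (fun u v h => (ho u v h).symm) k (fun m hm => (ih m hm).symm)
      (Ne.symm hne)
    have c := ho _ _ hne
    have hnek : e₁ (e₂.symm k) ≠ k := fun h => hne (by
      rw [← (Equiv.eq_symm_apply e₁).2 h])
    simp only [Equiv.apply_symm_apply] at c
    have d : e₂ (e₁.symm k) < k := lt_of_le_of_ne (not_lt.1 b) fun h => hnek (by
      rw [← (Equiv.eq_symm_apply e₂).2 h, Equiv.apply_symm_apply])
    exact a (c.2 d)

theorem mp_rep_unique {p : ℕ} {n : Fin p → ℕ} {o : AcyclicOrientation p n}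
    {l l' : List (Fin p)} (h : MPRep o l) (h' : MPRep o l') : l = l' := by
  obtain ⟨e, he, ho⟩ := h
  obtain ⟨e', he', ho'⟩ := h'
  have hlen : l.length = l'.length := by
    simpa using Fintype.card_congr (e.symm.trans e')
  have key := mp_word_eq (fun v : MPVertex p n => v.1) e (e'.trans (finCongr hlen.symm))
    (fun u v huv => by
      have := (ho u v).symm.trans (ho' u v)
      simp only [ne_eq, huv, not_false_eq_true, true_and] at this
      simpa using this)
  refine List.ext_get hlen fun k h1 h2 => ?_
  have hk := key ⟨k, h1⟩
  simp only [← he] at hk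
  rw [Equiv.apply_symm_apply] at hk
  rw [hk, he, ← he']
  simp

theorem mp_A_eq (p : ℕ) (n : Fin p → ℕ) : A p n = Nat.card (MPWord p n) := by
  let w : AcyclicOrientation p n → MPWord p n := fun o =>
    ⟨(mp_exists_rep o).choose, by
      obtain ⟨e, he, -⟩ := (mp_exists_rep o).choose_spec
      exact mp_count e he⟩
  have hw : ∀ o, MPRep o (w o).1 := fun o => (mp_exists_rep o).choose_spec
  let F : Quot (@PartIso p n) → MPWord p n := Quot.lift w fun o o' h =>
    Subtype.ext (mp_rep_unique (mp_rep_of_iso (hw o) h) (hw o'))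
  refine Nat.card_congr (Equiv.ofBijective F ⟨?_, ?_⟩)
  · rintro ⟨o⟩ ⟨o'⟩ h
    refine Quot.sound (mp_iso_of_rep (hw o) ?_)
    have h : w o = w o' := h
    rw [h]
    exact hw o'
  · rintro ⟨l, hl⟩
    obtain ⟨o, ho⟩ := mp_exists_of_word hl
    exact ⟨Quot.mk _ o, Subtype.ext (mp_rep_unique (hw o) ho)⟩

instance MPWord.finite (p : ℕ) (n : Fin p → ℕ) : Finite (MPWord p n) := by
  have : Finite {l : List (Fin p) // l.length = ∑ i, n i} :=
    inferInstanceAs (Finite (List.Vector (Fin p) (∑ i, n i)))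
  refine Finite.of_injective
    (fun l : MPWord p n => (⟨l.1, ?_⟩ : {l : List (Fin p) // l.length = ∑ i, n i})) ?_
  · rw [← Finset.sum_congr rfl fun i _ => l.2 i]
    have := Multiset.sum_count_eq_card (s := Finset.univ) (m := (l.1 : Multiset (Fin p)))
      (fun a _ => Finset.mem_univ a)
    simpa using this.symm
  · intro a b h
    have h' : a.1 = b.1 := by simpa using h
    exact Subtype.ext h'

theorem mp_count_cons {p : ℕ} (n : Fin p → ℕ) (j : Fin p) (l : List (Fin p)) :
    (∀ i, (j :: l).count i = n i) ↔
      1 ≤ n j ∧ ∀ i, l.count i = Function.update n j (n j - 1) i := by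
  constructor
  · intro h
    have hj := h j
    rw [List.count_cons_self] at hj
    refine ⟨by omega, fun i => ?_⟩
    by_cases hij : i = j
    · subst hij; simp; omega
    · rw [Function.update_of_ne hij, ← h i, List.count_cons_of_ne (Ne.symm hij)]
  · rintro ⟨h1, h⟩ i
    by_cases hij : i = j
    · subst hij
      have := h i
      simp at this
      rw [List.count_cons_self]; omega
    · rw [List.count_cons_of_ne (Ne.symm hij), h i, Function.update_of_ne hij]

theorem mp_word_recursion (p : ℕ) (n : Fin p → ℕ) (hn : 1 ≤ ∑ i, n i) :
    Nat.card (MPWord p n) = ∑ j ∈ Finset.univ.filter (fun j : Fin p => 1 ≤ n j),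
        Nat.card (MPWord p (Function.update n j (n j - 1))) := by
  let G : (Σ j : {j : Fin p // 1 ≤ n j}, MPWord p (Function.update n j.1 (n j.1 - 1))) →
      MPWord p n := fun x => ⟨x.1.1 :: x.2.1, (mp_count_cons n _ _).2 ⟨x.1.2, x.2.2⟩⟩
  have hG : Function.Bijective G := by
    constructor
    · rintro ⟨⟨j, hj⟩, ⟨l, hl⟩⟩ ⟨⟨j', hj'⟩, ⟨l', hl'⟩⟩ h
      have h := congrArg Subtype.val h
      simp only [G, List.cons.injEq] at h
      obtain ⟨rfl, rfl⟩ := h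
      rfl
    · rintro ⟨l, hl⟩
      cases l with
      | nil =>
        simp only [List.count_nil] at hl
        simp [← hl] at hn
      | cons j l =>
        have h := (mp_count_cons n j l).1 hl
        exact ⟨⟨⟨j, h.1⟩, ⟨l, h.2⟩⟩, rfl⟩
  rw [← Nat.card_congr (Equiv.ofBijective G hG), Nat.card_sigma]
  exact (Finset.sum_subtype _ (fun j => by simp)
    (fun j => Nat.card (MPWord p (Function.update n j (n j - 1))))).symm

/-- The numbers `A (n_1, …, n_p)` of non-isomorphic acyclic
orientations of `K_{n_1,…,n_p}` satisfy the recursion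
`A (n_1, …, n_p) = Σ_{j : n_j ≥ 1} A (n_1, …, n_j − 1, …, n_p)` whenever the graph
has at least one vertex, with `A (0, …, 0) = 1`. -/
theorem A_recursion (p : ℕ) (n : Fin p → ℕ) :
    (1 ≤ ∑ i, n i →
      A p n = ∑ j ∈ Finset.univ.filter (fun j : Fin p => 1 ≤ n j),
        A p (Function.update n j (n j - 1))) ∧
    A p (fun _ => 0) = 1 := by
  refine ⟨fun hn => ?_, ?_⟩
  · simp only [mp_A_eq]
    exact mp_word_recursion p n hn
  · rw [mp_A_eq, Nat.card_eq_one_iff_unique]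
    refine ⟨⟨?_⟩, ⟨⟨[], fun _ => rfl⟩⟩⟩
    have : ∀ l : MPWord p (fun _ => 0), l.1 = [] := by
      rintro ⟨l, hl⟩
      refine List.eq_nil_iff_forall_not_mem.2 fun a ha => ?_
      exact List.count_eq_zero.1 (hl a) ha
    intro a b
    exact Subtype.ext ((this a).trans (this b).symm)
end

section
/- The number of equivalence classes of acyclic orientations of the complete multipartite graph K_{n_1,…,n_p} under part-preserving isomorphism equals the multinomial coefficient (n_1 + n_2 + … + n_p)! / (n_1! · n_2! · … · n_p!). -/
noncomputable instance instFintypeMPVertex (p : ℕ) (n : Fin p → ℕ) :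
    Fintype (MPVertex p n) :=
  inferInstanceAs (Fintype (Σ i : Fin p, Fin (n i)))

/-- Key lemma: two rankings inducing the same orientation have the same word of parts. -/
theorem key_half {V ι : Type*} [Fintype V] {N : ℕ} (part : V → ι) (e e' : V ≃ Fin N)
    (h : ∀ u v, part u ≠ part v → (e u < e v ↔ e' u < e' v))
    (u v : V) (huv : e u = e' v) (hne : part u ≠ part v) (hlt : e u < e v) : False := by
  classical
  have hlt' : e' u < e' v := (h u v hne).1 hlt
  have hcard : ∀ f : V ≃ Fin N, (Finset.univ.filter (fun x => f x < e u)).card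
      = (Finset.univ.filter (fun y : Fin N => y < e u)).card := by
    intro f
    apply Finset.card_bij (fun x _ => f x)
    · intro a ha; simpa using ha
    · intro a _ b _ hab; exact f.injective hab
    · intro b hb; exact ⟨f.symm b, by simpa using hb, by simp⟩
  have hex : ∃ x, e x < e u ∧ ¬ e' x < e u := by
    by_contra hcon
    push Not at hcon
    have hsub : (Finset.univ.filter (fun x => e x < e u)) ⊆
        (Finset.univ.filter (fun x => e' x < e u)) := by
      intro x hx
      simp only [Finset.mem_filter, Finset.mem_univ, true_and] at hx ⊢
      exact hcon x hx
    have heq := Finset.eq_of_subset_of_card_le hsub (by rw [hcard e, hcard e'])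
    have hu : u ∈ (Finset.univ.filter (fun x => e' x < e u)) := by
      simp [huv, hlt']
    rw [← heq] at hu
    simp at hu
  obtain ⟨x, hx1, hx2⟩ := hex
  rw [huv, not_lt] at hx2
  have hxu : part x = part u := by
    by_contra hc
    exact absurd ((h x u hc).1 hx1) (not_lt.2 (hlt'.le.trans hx2))
  have hxv : part x = part v := by
    by_contra hc
    exact absurd ((h x v hc).1 (hx1.trans hlt)) (not_lt.2 hx2)
  exact hne (hxu.symm.trans hxv)

theorem key_lemma {V ι : Type*} [Fintype V] {N : ℕ} (part : V → ι) (e e' : V ≃ Fin N)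
    (h : ∀ u v, part u ≠ part v → (e u < e v ↔ e' u < e' v))
    (u v : V) (huv : e u = e' v) : part u = part v := by
  by_contra hne
  rcases lt_trichotomy (e u) (e v) with hl | hl | hl
  · exact key_half part e e' h u v huv hne hl
  · exact hne (by rw [e.injective hl])
  · have h1 : e' v < e' u := (h v u (Ne.symm hne)).1 hl
    exact key_half part e' e (fun a b hab => (h a b hab).symm) v u huv.symm (Ne.symm hne) h1

/-- The acyclic orientation induced by a ranking of the vertices. -/
def rankOrientation {p : ℕ} {n : Fin p → ℕ} {N : ℕ} (e : MPVertex p n ≃ Fin N) :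
    AcyclicOrientation p n :=
  ⟨fun u v => u.1 ≠ v.1 ∧ e u < e v, fun _ _ h => h.1, by
    intro u v huv
    rcases lt_trichotomy (e u) (e v) with hl | hl | hl
    · exact Or.inl ⟨⟨huv, hl⟩, fun h => absurd h.2 (not_lt.2 hl.le)⟩
    · exact absurd (congrArg Sigma.fst (e.injective hl)) huv
    · exact Or.inr ⟨⟨huv.symm, hl⟩, fun h => absurd h.2 (not_lt.2 hl.le)⟩, by
    intro u hu
    have : ∀ v, Relation.TransGen
        (fun u v : MPVertex p n => u.1 ≠ v.1 ∧ e u < e v) u v → e u < e v := by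
      intro v hv
      induction hv with
      | single h => exact h.2
      | tail _ h ih => exact ih.trans h.2
    exact lt_irrefl _ (this u hu)⟩

theorem rankOrientation_surj {p : ℕ} {n : Fin p → ℕ} (o : AcyclicOrientation p n) :
    ∃ e : MPVertex p n ≃ Fin (Fintype.card (MPVertex p n)), rankOrientation e = o := by
  classical
  obtain ⟨o, h1, h2, h3⟩ := o
  have hr : IsPartialOrder (MPVertex p n) (Relation.ReflTransGen o) :=
    { refl := fun a => Relation.ReflTransGen.refl
      trans := fun a b c h h' => h.trans h'
      antisymm := fun a b h h' => by
        rcases Relation.reflTransGen_iff_eq_or_transGen.1 h with rfl | hh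
        · rfl
        · exact absurd (hh.trans_left h') (h3 a) }
  obtain ⟨s, hs, hrs⟩ := extend_partialOrder (Relation.ReflTransGen o)
  let _ : LinearOrder (MPVertex p n) :=
    { le := s
      le_refl := fun a => hs.refl a
      le_trans := fun a b c => hs.trans a b c
      le_antisymm := fun a b => hs.antisymm a b
      le_total := fun a b => hs.total a b
      toDecidableLE := Classical.decRel _ }
  let E := (monoEquivOfFin (MPVertex p n) rfl).symm
  have hlt : ∀ u v, o u v → E u < E v := by
    intro u v huv
    apply lt_of_le_of_ne
    · exact E.monotone (hrs u v (Relation.ReflTransGen.single huv))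
    · intro h
      exact h1 u v huv (congrArg Sigma.fst (E.injective h))
  refine ⟨E.toEquiv, Subtype.ext ?_⟩
  funext u v
  apply propext
  constructor
  · rintro ⟨hne, hl⟩
    rcases h2 u v hne with h | h
    · exact h.1
    · exact absurd (hlt v u h.1) (not_lt.2 (le_of_lt hl))
  · intro h
    exact ⟨h1 u v h, hlt u v h⟩

theorem partIso_equivalence {p : ℕ} {n : Fin p → ℕ} : Equivalence (@PartIso p n) where
  refl o := ⟨Equiv.refl _, fun _ => rfl, fun _ _ => Iff.rfl⟩
  symm := by
    rintro a b ⟨σ, h1, h2⟩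
    refine ⟨σ.symm, fun v => ?_, fun u v => ?_⟩
    · rw [← h1 (σ.symm v), σ.apply_symm_apply]
    · rw [← h2, σ.apply_symm_apply, σ.apply_symm_apply]
  trans := by
    rintro a b c ⟨σ, h1, h2⟩ ⟨τ, h3, h4⟩
    refine ⟨σ.trans τ, fun v => ?_, fun u v => ?_⟩
    · exact (h3 _).trans (h1 v)
    · exact (h4 _ _).trans (h2 u v)

theorem partIso_rank_iff {p : ℕ} {n : Fin p → ℕ} {N : ℕ} (e e' : MPVertex p n ≃ Fin N) :
    PartIso (rankOrientation e) (rankOrientation e') ↔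
      (Sigma.fst ∘ (e.trans e'.symm) : MPVertex p n → Fin p) = Sigma.fst := by
  constructor
  · rintro ⟨σ, h1, h2⟩
    funext u
    have := key_lemma (fun x : MPVertex p n => x.1) e (σ.trans e') (by
      intro a b hab
      have hh := h2 a b
      simp only [rankOrientation, h1] at hh
      have hh' := and_congr_right_iff.1 hh hab
      exact hh'.symm) u (σ.symm (e'.symm (e u))) (by simp)
    have h5 := h1 (σ.symm (e'.symm (e u)))
    rw [σ.apply_symm_apply] at h5
    exact h5.trans this.symm
  · intro h
    refine ⟨e.trans e'.symm, fun v => congrFun h v, fun u v => ?_⟩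
    have hu : ((e.trans e'.symm) u).1 = u.1 := congrFun h u
    have hv : ((e.trans e'.symm) v).1 = v.1 := congrFun h v
    simp only [rankOrientation, hu, hv]
    simp

/-- The number of non-isomorphic (under part-preserving
isomorphism) acyclic orientations of `K_{n_1,…,n_p}` is the multinomial
coefficient `(n_1 + … + n_p)! / (n_1! ⋯ n_p!)`. -/
theorem A_eq_multinomial (p : ℕ) (n : Fin p → ℕ) :
    A p n = Nat.multinomial Finset.univ n := by
  classical
  let V := MPVertex p n
  let N := Fintype.card V
  let f : V → Fin p := Sigma.fst
  let F : (V ≃ Fin N) → Quot (@PartIso p n) := fun e => Quot.mk _ (rankOrientation e)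
  have hF : ∀ e e', F e = F e' ↔ f ∘ (e.trans e'.symm) = f := by
    intro e e'
    exact (Quot.eq.trans (by rw [partIso_equivalence.eqvGen_iff])).trans
      (partIso_rank_iff e e')
  have hsurj : ∀ q, ∃ e, F e = q := by
    intro q
    induction q using Quot.ind with
    | mk o =>
      obtain ⟨e, he⟩ := rankOrientation_surj o
      exact ⟨e, by simp only [F, N, V, he]⟩
  choose g hg using hsurj
  have hfib : ∀ q, Nonempty ({e // F e = q} ≃ {τ : Equiv.Perm V // f ∘ τ = f}) := by
    intro q
    refine ⟨
      { toFun := fun e => ⟨e.1.trans (g q).symm, (hF _ _).1 (e.2.trans (hg q).symm)⟩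
        invFun := fun τ => ⟨τ.1.trans (g q), ?_⟩
        left_inv := ?_
        right_inv := ?_ }⟩
    · refine Eq.trans ((hF _ _).2 ?_) (hg q)
      rw [Equiv.trans_assoc, Equiv.self_trans_symm, Equiv.trans_refl]
      exact τ.2
    · intro e
      apply Subtype.ext
      ext x
      simp
    · intro τ
      apply Subtype.ext
      ext x
      simp
  have hcong := Nat.card_congr ((Equiv.sigmaFiberEquiv F).symm.trans
    ((Equiv.sigmaCongrRight fun q => (hfib q).some).trans (Equiv.sigmaEquivProd _ _)))
  rw [Nat.card_prod, Nat.card_eq_fintype_card (α := {τ : Equiv.Perm V // f ∘ τ = f}),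
    DomMulAct.stabilizer_card f, Nat.card_eq_fintype_card,
    Fintype.card_equiv (Fintype.equivFin V)] at hcong
  have hpart : ∀ i, Fintype.card {a // f a = i} = n i := by
    intro i
    have E : {a // f a = i} ≃ Fin (n i) :=
      { toFun := fun a => Fin.cast (congrArg n a.2) a.1.2
        invFun := fun x => ⟨⟨i, x⟩, rfl⟩
        left_inv := by
          rintro ⟨⟨j, x⟩, rfl⟩
          rfl
        right_inv := fun x => rfl }
    rw [Fintype.card_congr E, Fintype.card_fin]
  have hV : Fintype.card V = ∑ i, n i := by
    have : Fintype.card (Σ i : Fin p, Fin (n i)) = ∑ i, n i := by simp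
    rw [← this]
    exact Fintype.card_congr (Equiv.refl _)
  simp only [hpart, hV] at hcong
  rw [← Nat.multinomial_spec, mul_comm] at hcong
  exact (Nat.eq_of_mul_eq_mul_right
    (Finset.prod_pos fun i _ => Nat.factorial_pos _) hcong).symm
end

section
/- Let n_1,…,n_p ≥ 1 and N = n_1 + … + n_p ≥ 2. The number of equivalence classes under graph isomorphism of acyclic orientations of K_{n_1,…,n_p} that contain a directed spanning tree (equivalently, that have a unique source) equals [(N! / (n_1! ⋯ n_p!)) / (r_1! ⋯ r_s!)] · (N² − Σ_{i=1}^p n_i²) / (N(N−1)), where r_1,…,r_s are the multiplicities with which each distinct size occurs among n_1,…,n_p. -/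
/-- Acyclic orientations of `K_{n 0, …, n (p-1)}` containing a directed spanning
tree, i.e. having a vertex from which every vertex is reachable by a directed
path. -/
def SpanningAcyclicOrientation (p : ℕ) (n : Fin p → ℕ) : Type :=
  { o : AcyclicOrientation p n // ∃ r : MPVertex p n, ∀ v, Relation.ReflTransGen o.1 r v }

/-- (Arbitrary) isomorphism of orientations with a directed spanning tree:
a bijection `σ` of the vertices and a permutation `τ` of the parts with
`part ∘ σ = τ ∘ part`, transporting one orientation to the other. -/
def SpanOrIso {p : ℕ} {n : Fin p → ℕ} (o₁ o₂ : SpanningAcyclicOrientation p n) : Prop :=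
  ∃ (σ : MPVertex p n ≃ MPVertex p n) (τ : Equiv.Perm (Fin p)),
    (∀ v, (σ v).1 = τ v.1) ∧ ∀ u v, o₂.1.1 (σ u) (σ v) ↔ o₁.1.1 u v

/-- `C p n` is the number of equivalence classes, under graph isomorphism, of
acyclic orientations of `K_{n 0, …, n (p-1)}` containing a directed spanning
tree. -/
noncomputable def C (p : ℕ) (n : Fin p → ℕ) : ℕ :=
  Nat.card (Quot (@SpanOrIso p n))

open Finset in
/-- Two linear orders inducing the same orientation have the same word of parts. -/
theorem part_word_eq {V P : Type} {N : ℕ} (part : V → P) (e e' : Fin N ≃ V)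
    (h : ∀ u v, part u ≠ part v → (e.symm u < e.symm v ↔ e'.symm u < e'.symm v)) :
    ∀ k, part (e k) = part (e' k) := by
  classical
  -- asymmetric step
  have key : ∀ (e e' : Fin N ≃ V),
      (∀ u v, part u ≠ part v → (e.symm u < e.symm v ↔ e'.symm u < e'.symm v)) →
      ∀ k, (∀ j < k, part (e j) = part (e' j)) → part (e k) ≠ part (e' k) →
      e.symm (e k) < e.symm (e' k) → False := by
    intro e e' h k ih hne hlt
    have h1 : (univ.filter fun j : Fin N => part (e j) = part (e k) ∧ j < e.symm (e' k)).card
        = (univ.filter fun j : Fin N => part (e' j) = part (e k) ∧ j < k).card := by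
      refine Finset.card_bij (fun j _ => e'.symm (e j)) ?_ ?_ ?_
      · intro j hj
        simp only [mem_filter, mem_univ, true_and] at hj ⊢
        refine ⟨by simpa using hj.1, ?_⟩
        have := (h (e j) (e' k) (by rw [hj.1]; exact hne)).1 (by simpa using hj.2)
        simpa using this
      · intro a _ b _ hab
        simpa using hab
      · intro b hb
        simp only [mem_filter, mem_univ, true_and] at hb
        refine ⟨e.symm (e' b), ?_, by simp⟩
        simp only [mem_filter, mem_univ, true_and]
        refine ⟨by simpa using hb.1, ?_⟩
        exact (h (e' b) (e' k) (by rw [hb.1]; exact hne)).2 (by simpa using hb.2)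
    have h2 : (univ.filter fun j : Fin N => part (e' j) = part (e k) ∧ j < k) ⊂
        (univ.filter fun j : Fin N => part (e j) = part (e k) ∧ j < e.symm (e' k)) := by
      rw [Finset.ssubset_iff_of_subset]
      · refine ⟨k, ?_, ?_⟩
        · simpa using hlt
        · simp
      · intro j hj
        simp only [mem_filter, mem_univ, true_and] at hj ⊢
        rw [ih j hj.2]
        refine ⟨hj.1, hj.2.trans ?_⟩
        simpa using hlt
    have := Finset.card_lt_card h2
    omega
  intro k
  induction k using WellFoundedLT.induction with
  | ind k ih =>
    by_contra hne
    rcases lt_trichotomy (e.symm (e k)) (e.symm (e' k)) with hlt | heq | hgt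
    · exact key e e' h k ih hne hlt
    · exact hne (by rw [e.symm.injective heq])
    · refine key e' e (fun u v huv => (h u v huv).symm) k (fun j hj => (ih j hj).symm)
        (fun h => hne h.symm) ?_
      exact (h _ _ (fun h => hne h.symm)).1 hgt

instance mpFintype (p : ℕ) (n : Fin p → ℕ) : Fintype (MPVertex p n) :=
  inferInstanceAs (Fintype (Σ i : Fin p, Fin (n i)))

theorem mp_card (p : ℕ) (n : Fin p → ℕ) : Fintype.card (MPVertex p n) = ∑ i, n i := by
  have : Fintype.card (Σ i : Fin p, Fin (n i)) = ∑ i, n i := by simp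
  exact this

theorem mp_fiber_card (p : ℕ) (n : Fin p → ℕ) (i : Fin p) :
    Nat.card {v : MPVertex p n // v.1 = i} = n i := by
  have : {v : MPVertex p n // v.1 = i} ≃ Fin (n i) := Equiv.sigmaSubtype i
  rw [Nat.card_congr this, Nat.card_fin]

/-- Automorphisms of the multipartite graph, with the action on the parts. -/
def MPAut (p : ℕ) (n : Fin p → ℕ) : Type :=
  {x : Equiv.Perm (MPVertex p n) × Equiv.Perm (Fin p) // ∀ v, (x.1 v).1 = x.2 v.1}

def liftPerm {p : ℕ} {n : Fin p → ℕ} (τ : {τ : Equiv.Perm (Fin p) // n ∘ τ = n}) :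
    Equiv.Perm (MPVertex p n) :=
  Equiv.sigmaCongr τ.1 (fun i => finCongr (congrFun τ.2 i).symm)

theorem liftPerm_fst {p : ℕ} {n : Fin p → ℕ} (τ : {τ : Equiv.Perm (Fin p) // n ∘ τ = n})
    (v : MPVertex p n) : (liftPerm τ v).1 = τ.1 v.1 := rfl

theorem aut_size {p : ℕ} {n : Fin p → ℕ} (σ : Equiv.Perm (MPVertex p n))
    (τ : Equiv.Perm (Fin p)) (h : ∀ v, (σ v).1 = τ v.1) : n ∘ τ = n := by
  funext i
  have e : {v : MPVertex p n // v.1 = i} ≃ {v : MPVertex p n // v.1 = τ i} :=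
    σ.subtypeEquiv (fun v => by rw [h]; simp)
  have := Nat.card_congr e
  rw [mp_fiber_card, mp_fiber_card] at this
  simpa using this.symm

def autMap (p : ℕ) (n : Fin p → ℕ)
    (x : {τ : Equiv.Perm (Fin p) // n ∘ τ = n} ×
      {g : Equiv.Perm (MPVertex p n) // (fun v : MPVertex p n => v.1) ∘ g = fun v => v.1}) :
    MPAut p n :=
  ⟨(liftPerm x.1 * x.2.1, x.1.1), fun v => by
    have := congrFun x.2.2 v
    simp only [Function.comp] at this
    simp [liftPerm_fst, this]⟩

theorem autMap_bij (p : ℕ) (n : Fin p → ℕ) : Function.Bijective (autMap p n) := by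
  constructor
  · rintro ⟨τ, g⟩ ⟨τ', g'⟩ h
    have h1 := congrArg (fun x => x.1.1) h
    have h2 := congrArg (fun x => x.1.2) h
    simp only [autMap] at h1 h2
    obtain rfl : τ = τ' := Subtype.ext h2
    have : g = g' := Subtype.ext (mul_left_cancel h1)
    rw [this]
  · rintro ⟨⟨σ, τ⟩, h⟩
    simp only at h
    refine ⟨(⟨τ, aut_size σ τ h⟩, ⟨(liftPerm ⟨τ, aut_size σ τ h⟩)⁻¹ * σ, ?_⟩), ?_⟩
    · funext v
      have := liftPerm_fst ⟨τ, aut_size σ τ h⟩ ((liftPerm ⟨τ, aut_size σ τ h⟩)⁻¹ (σ v))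
      rw [← Equiv.Perm.mul_apply, mul_inv_cancel, Equiv.Perm.one_apply, h] at this
      exact (τ.injective this).symm
    · apply Subtype.ext
      simp [autMap]

theorem aut_card (p : ℕ) (n : Fin p → ℕ) :
    Nat.card (MPAut p n) =
      (∏ m ∈ Finset.image n Finset.univ,
        (Finset.univ.filter (fun i : Fin p => n i = m)).card.factorial) *
      ∏ i, (n i).factorial := by
  classical
  rw [← Nat.card_congr (Equiv.ofBijective _ (autMap_bij p n)), Nat.card_prod]
  congr 1
  · rw [Nat.card_eq_fintype_card, DomMulAct.stabilizer_card']
    simp [Fintype.card_subtype]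
  · rw [Nat.card_eq_fintype_card, DomMulAct.stabilizer_card]
    refine Finset.prod_congr rfl fun i _ => ?_
    rw [← Nat.card_eq_fintype_card, mp_fiber_card]

/-- Linear orders of the vertices whose first two vertices lie in different parts. -/
def GoodOrder (p : ℕ) (n : Fin p → ℕ) (N : ℕ) (a b : Fin N) : Type :=
  {e : Fin N ≃ MPVertex p n // (e a).1 ≠ (e b).1}

instance (p : ℕ) (n : Fin p → ℕ) (N : ℕ) (a b : Fin N) : Finite (GoodOrder p n N a b) :=
  inferInstanceAs (Finite {e : Fin N ≃ MPVertex p n // (e a).1 ≠ (e b).1})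

theorem goodOrder_card_eq (p : ℕ) (n : Fin p → ℕ) (N : ℕ) (a b c d : Fin N)
    (hab : a ≠ b) (hcd : c ≠ d) :
    Nat.card (GoodOrder p n N a b) = Nat.card (GoodOrder p n N c d) := by
  obtain ⟨g, h1, h2⟩ := (MulAction.is_two_pretransitive_iff (G := Equiv.Perm (Fin N))).1
    (Equiv.Perm.isMultiplyPretransitive (Fin N) 2) hab hcd
  simp only [Equiv.Perm.smul_def] at h1 h2
  subst h1 h2
  refine Nat.card_congr (Equiv.subtypeEquiv (Equiv.equivCongr g (Equiv.refl _)) ?_)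
  intro e
  simp [Equiv.equivCongr]

theorem pair_card (p : ℕ) (n : Fin p → ℕ) (N : ℕ) (hN : N = ∑ i, n i) :
    Nat.card {x : MPVertex p n × MPVertex p n // x.1.1 ≠ x.2.1} = N ^ 2 - ∑ i, n i ^ 2 := by
  classical
  have h1 : Nat.card {x : MPVertex p n × MPVertex p n // x.1.1 = x.2.1} = ∑ i, n i ^ 2 := by
    have e : {x : MPVertex p n × MPVertex p n // x.1.1 = x.2.1} ≃
        Σ i : Fin p, Fin (n i) × Fin (n i) :=
      { toFun := fun x => ⟨x.1.1.1, (x.1.1.2, Fin.cast (by rw [x.2]) x.1.2.2)⟩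
        invFun := fun y => ⟨(⟨y.1, y.2.1⟩, ⟨y.1, y.2.2⟩), rfl⟩
        left_inv := by
          rintro ⟨⟨⟨i, x⟩, ⟨j, y⟩⟩, h⟩
          simp only at h
          subst h
          rfl
        right_inv := by
          rintro ⟨i, x, y⟩
          rfl }
    rw [Nat.card_congr e]
    simp [Nat.card_eq_fintype_card, sq]
  have h2 := Fintype.card_subtype_compl (fun x : MPVertex p n × MPVertex p n => x.1.1 = x.2.1)
  rw [← Nat.card_eq_fintype_card, ← Nat.card_eq_fintype_card (α := Subtype _), h1,
    Fintype.card_prod, mp_card, ← hN, ← sq] at h2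
  exact h2

theorem goodOrder_card (p : ℕ) (n : Fin p → ℕ) (N : ℕ) (hN : N = ∑ i, n i) (a b : Fin N)
    (hab : a ≠ b) :
    Nat.card (GoodOrder p n N a b) * (N * (N - 1)) = N.factorial * (N ^ 2 - ∑ i, n i ^ 2) := by
  classical
  -- triples (e, i, j) with e i, e j in different parts
  have e1 : (Σ x : {x : Fin N × Fin N // x.1 ≠ x.2}, GoodOrder p n N x.1.1 x.1.2) ≃
      (Fin N ≃ MPVertex p n) × {x : MPVertex p n × MPVertex p n // x.1.1 ≠ x.2.1} :=
    { toFun := fun y => (y.2.1, ⟨(y.2.1 y.1.1.1, y.2.1 y.1.1.2), y.2.2⟩)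
      invFun := fun z => ⟨⟨(z.1.symm z.2.1.1, z.1.symm z.2.1.2), fun h => z.2.2 (by
          rw [z.1.symm.injective h])⟩, ⟨z.1, by simpa using z.2.2⟩⟩
      left_inv := by
        rintro ⟨⟨⟨i, j⟩, hij⟩, ⟨e, he⟩⟩
        refine Sigma.ext (by simp) ?_
        simp only
        congr 1 <;> simp
      right_inv := by
        rintro ⟨e, ⟨⟨u, v⟩, huv⟩⟩
        simp }
  have h := Nat.card_congr e1
  rw [Nat.card_prod, pair_card p n N hN, Nat.card_sigma,
    Finset.sum_congr rfl (fun x _ => goodOrder_card_eq p n N x.1.1 x.1.2 a b x.2 hab),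
    Finset.sum_const, smul_eq_mul] at h
  have h3 : Nat.card (Fin N ≃ MPVertex p n) = N.factorial := by
    have e0 : Fin N ≃ MPVertex p n := Fintype.equivOfCardEq (by rw [mp_card, ← hN]; simp)
    rw [Nat.card_eq_fintype_card, Fintype.card_equiv e0, Fintype.card_fin]
  have h4 : (Finset.univ : Finset {x : Fin N × Fin N // x.1 ≠ x.2}).card = N * (N - 1) := by
    rw [Finset.card_univ, Fintype.card_subtype]
    have := Finset.offDiag_card (Finset.univ : Finset (Fin N))
    rw [Finset.card_univ, Fintype.card_fin] at this
    rw [Nat.mul_sub, mul_one, ← this]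
    congr 1
    ext x
    simp
  rw [h3, h4] at h
  rw [← h, mul_comm]

/-- The orientation induced by a linear order. -/
def orderRel {p : ℕ} {n : Fin p → ℕ} {N : ℕ} (e : Fin N ≃ MPVertex p n)
    (u v : MPVertex p n) : Prop := u.1 ≠ v.1 ∧ e.symm u < e.symm v

theorem orderRel_transGen {p : ℕ} {n : Fin p → ℕ} {N : ℕ} (e : Fin N ≃ MPVertex p n)
    {u v : MPVertex p n} (h : Relation.TransGen (orderRel e) u v) : e.symm u < e.symm v := by
  induction h with
  | single h => exact h.2
  | tail _ h ih => exact ih.trans h.2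

def orderOr {p : ℕ} {n : Fin p → ℕ} {N : ℕ} (e : Fin N ≃ MPVertex p n) :
    AcyclicOrientation p n :=
  ⟨orderRel e, fun _ _ h => h.1, fun u v h => by
    have hne : e.symm u ≠ e.symm v := fun h' => h (by rw [e.symm.injective h'])
    rcases lt_or_gt_of_ne hne with h1 | h1
    · exact Or.inl ⟨⟨h, h1⟩, fun h2 => absurd h2.2 h1.not_gt⟩
    · exact Or.inr ⟨⟨h.symm, h1⟩, fun h2 => absurd h2.2 h1.not_gt⟩,
    fun u h => lt_irrefl _ (orderRel_transGen e h)⟩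

def goodOr {p : ℕ} {n : Fin p → ℕ} {N : ℕ} (hN2 : 2 ≤ N)
    (e : GoodOrder p n N ⟨0, by omega⟩ ⟨1, by omega⟩) : SpanningAcyclicOrientation p n :=
  ⟨orderOr e.1, e.1 ⟨0, by omega⟩, fun v => by
    obtain ⟨e, he⟩ := e
    obtain ⟨k, rfl⟩ := e.surjective v
    by_cases h : (e ⟨0, by omega⟩).1 = (e k).1
    · by_cases h0 : k = ⟨0, by omega⟩
      · rw [h0]
      · have h1 : k ≠ ⟨1, by omega⟩ := by
          intro h1
          rw [h1] at h
          exact he h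
        refine Relation.ReflTransGen.head (b := e ⟨1, by omega⟩) ?_ (Relation.ReflTransGen.single ?_)
        · refine ⟨he, ?_⟩
          simp
        · refine ⟨fun h' => he (h.trans h'.symm), ?_⟩
          simp only [Equiv.symm_apply_apply, Fin.lt_def]
          simp only [ne_eq, Fin.ext_iff] at h0 h1
          omega
    · refine Relation.ReflTransGen.single ⟨h, ?_⟩
      have h0 : k ≠ ⟨0, by omega⟩ := by
        intro h0
        rw [h0] at h
        exact h rfl
      simp only [Equiv.symm_apply_apply, Fin.lt_def]
      simp only [ne_eq, Fin.ext_iff] at h0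
      omega⟩

theorem exists_order {p : ℕ} {n : Fin p → ℕ} {N : ℕ} (hN : N = ∑ i, n i)
    (o : AcyclicOrientation p n) : ∃ e : Fin N ≃ MPVertex p n, o.1 = orderRel e := by
  classical
  obtain ⟨o, h1, h2, h3⟩ := o
  have hpo : IsPartialOrder (MPVertex p n) (Relation.ReflTransGen o) :=
    { refl := fun _ => Relation.ReflTransGen.refl
      trans := fun _ _ _ => Relation.ReflTransGen.trans
      antisymm := fun u v huv hvu => by
        by_contra hne
        rcases Relation.reflTransGen_iff_eq_or_transGen.1 huv with h | h
        · exact hne h.symm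
        · exact h3 u (h.trans_left hvu) }
  obtain ⟨s, hs, hle⟩ := extend_partialOrder (Relation.ReflTransGen o)
  letI : LinearOrder (MPVertex p n) :=
    { le := s
      le_refl := hs.refl
      le_trans := hs.trans
      le_antisymm := hs.antisymm
      le_total := hs.total
      toDecidableLE := Classical.decRel _ }
  have e : Fin N ≃o MPVertex p n :=
    Fintype.orderIsoFinOfCardEq (MPVertex p n) (by rw [mp_card, hN])
  have hlt : ∀ u v, o u v → e.symm u < e.symm v := by
    intro u v huv
    rw [OrderIso.lt_iff_lt]
    refine lt_of_le_of_ne (hle u v (Relation.ReflTransGen.single huv)) ?_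
    rintro rfl
    exact h1 _ _ huv rfl
  refine ⟨e.toEquiv, ?_⟩
  funext u v
  refine propext ⟨fun h => ⟨h1 _ _ h, hlt _ _ h⟩, fun h => ?_⟩
  rcases h2 u v h.1 with h' | h'
  · exact h'.1
  · exact absurd (hlt _ _ h'.1) (not_lt_of_gt h.2)

theorem goodOr_surj {p : ℕ} {n : Fin p → ℕ} {N : ℕ} (hN : N = ∑ i, n i) (hN2 : 2 ≤ N)
    (o : SpanningAcyclicOrientation p n) : ∃ e, goodOr (n := n) hN2 e = o := by
  obtain ⟨o, r, hr⟩ := o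
  obtain ⟨e, he⟩ := exists_order hN o
  have hle : ∀ v, e.symm r ≤ e.symm v := by
    intro v
    have := hr v
    rw [he] at this
    rcases Relation.reflTransGen_iff_eq_or_transGen.1 this with h | h
    · rw [h]
    · exact (orderRel_transGen e h).le
  have hr0 : e.symm r = ⟨0, by omega⟩ := by
    have := hle (e ⟨0, by omega⟩)
    simp only [Equiv.symm_apply_apply, Fin.le_def] at this
    rw [Fin.ext_iff]
    simpa using this
  have hgood : (e ⟨0, by omega⟩).1 ≠ (e ⟨1, by omega⟩).1 := by
    have h := hr (e ⟨1, by omega⟩)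
    rw [he] at h
    rcases Relation.ReflTransGen.cases_tail h with h | ⟨c, _, h⟩
    · rw [← h] at hr0
      simp at hr0
    · have h2 := h.2
      simp only [Equiv.symm_apply_apply, Fin.lt_def] at h2
      have hc : e.symm c = ⟨0, by omega⟩ := by
        rw [Fin.ext_iff]
        simp only
        omega
      rw [← hc, Equiv.apply_symm_apply]
      exact h.1
  exact ⟨⟨e, hgood⟩, Subtype.ext (Subtype.ext he.symm)⟩

theorem spanOrIso_equiv (p : ℕ) (n : Fin p → ℕ) : Equivalence (@SpanOrIso p n) where
  refl o := ⟨Equiv.refl _, Equiv.refl _, fun _ => rfl, fun _ _ => Iff.rfl⟩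
  symm := by
    rintro o₁ o₂ ⟨σ, τ, h1, h2⟩
    refine ⟨σ.symm, τ.symm, fun v => ?_, fun u v => ?_⟩
    · rw [Equiv.eq_symm_apply, ← h1, Equiv.apply_symm_apply]
    · rw [← h2]; simp
  trans := by
    rintro o₁ o₂ o₃ ⟨σ, τ, h1, h2⟩ ⟨σ', τ', h1', h2'⟩
    refine ⟨σ.trans σ', τ.trans τ', fun v => ?_, fun u v => ?_⟩
    · simp [h1, h1']
    · simp [h2, h2']

theorem goodOr_iso_iff {p : ℕ} {n : Fin p → ℕ} {N : ℕ} (hN2 : 2 ≤ N)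
    (e e' : GoodOrder p n N ⟨0, by omega⟩ ⟨1, by omega⟩) :
    SpanOrIso (goodOr hN2 e) (goodOr hN2 e') ↔
      ∃ τ : Equiv.Perm (Fin p), ∀ k, (e'.1 k).1 = τ (e.1 k).1 := by
  constructor
  · rintro ⟨σ, τ, h1, h2⟩
    refine ⟨τ, fun k => ?_⟩
    rw [← h1]
    refine part_word_eq (fun v : MPVertex p n => v.1) e'.1 (e.1.trans σ) ?_ k
    intro u v huv
    have := h2 (σ.symm u) (σ.symm v)
    simp only [Equiv.apply_symm_apply] at this
    have h3 : (σ.symm u).1 ≠ (σ.symm v).1 := by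
      intro h
      apply huv
      have := congrArg τ h
      rw [← h1, ← h1] at this
      simpa using this
    have h4 : (u.1 ≠ v.1 ∧ e'.1.symm u < e'.1.symm v) ↔
      ((σ.symm u).1 ≠ (σ.symm v).1 ∧ e.1.symm (σ.symm u) < e.1.symm (σ.symm v)) := this
    simpa [h3, huv] using h4
  · rintro ⟨τ, h⟩
    have h' : ∀ v, (e'.1 (e.1.symm v)).1 = τ v.1 := fun v => by rw [h]; simp
    refine ⟨e.1.symm.trans e'.1, τ, h', fun u v => ?_⟩
    change (_ ∧ _) ↔ (_ ∧ _)
    simp [h']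

theorem main_count (p : ℕ) (n : Fin p → ℕ) (hn : ∀ i, 1 ≤ n i)
    (N : ℕ) (hN : N = ∑ i, n i) (hN2 : 2 ≤ N) :
    Nat.card (GoodOrder p n N ⟨0, by omega⟩ ⟨1, by omega⟩) = C p n * Nat.card (MPAut p n) := by
  classical
  let f : GoodOrder p n N ⟨0, by omega⟩ ⟨1, by omega⟩ → Quot (@SpanOrIso p n) :=
    fun e => Quot.mk _ (goodOr hN2 e)
  have hf : ∀ e e', f e = f e' ↔ ∃ τ : Equiv.Perm (Fin p), ∀ k, (e'.1 k).1 = τ (e.1 k).1 := by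
    intro e e'
    rw [← goodOr_iso_iff hN2 e e']
    exact ⟨fun h => (spanOrIso_equiv p n).eqvGen_iff.1 (Quot.eqvGen_exact h), Quot.sound⟩
  have hsurj : Function.Surjective f := by
    intro q
    obtain ⟨o, rfl⟩ := Quot.exists_rep q
    obtain ⟨e, rfl⟩ := goodOr_surj hN hN2 o
    exact ⟨e, rfl⟩
  choose g hg using hsurj
  have hgood : ∀ q (x : MPAut p n),
      (((g q).1.trans x.1.1) ⟨0, by omega⟩).1 ≠ (((g q).1.trans x.1.1) ⟨1, by omega⟩).1 := by
    intro q x h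
    simp only [Equiv.trans_apply, x.2] at h
    exact (g q).2 (x.1.2.injective h)
  let F : Quot (@SpanOrIso p n) × MPAut p n → GoodOrder p n N ⟨0, by omega⟩ ⟨1, by omega⟩ :=
    fun y => ⟨(g y.1).1.trans y.2.1.1, hgood y.1 y.2⟩
  have hF : ∀ y, f (F y) = y.1 := by
    intro y
    conv_rhs => rw [← hg y.1]
    refine ((hf _ _).2 ⟨y.2.1.2, fun k => ?_⟩).symm
    exact y.2.2 _
  have hbij : Function.Bijective F := by
    constructor
    · rintro ⟨q, x⟩ ⟨q', x'⟩ h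
      have hq : q = q' := by
        have := congrArg f h
        rwa [hF, hF] at this
      subst hq
      have h1 : (g q).1.trans x.1.1 = (g q).1.trans x'.1.1 := congrArg Subtype.val h
      have h2 : x.1.1 = x'.1.1 := by
        ext v : 1
        have := Equiv.congr_fun h1 ((g q).1.symm v)
        simpa using this
      have h3 : x.1.2 = x'.1.2 := by
        ext i : 1
        have a := x.2 ⟨i, ⟨0, hn i⟩⟩
        have b := x'.2 ⟨i, ⟨0, hn i⟩⟩
        rw [← h2, a] at b
        exact b
      have : x = x' := Subtype.ext (Prod.ext h2 h3)
      rw [this]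
    · intro e
      obtain ⟨τ, hτ⟩ := (hf (g (f e)) e).1 (hg _)
      refine ⟨(f e, ⟨((g (f e)).1.symm.trans e.1, τ), fun v => ?_⟩), ?_⟩
      · simp [hτ]
      · apply Subtype.ext
        ext k : 1
        simp [F]
  rw [← Nat.card_congr (Equiv.ofBijective F hbij), Nat.card_prod]
  rfl

/-- For `n_1, …, n_p ≥ 1` with `N = n_1 + … + n_p ≥ 2`, the number
of non-isomorphic acyclic orientations of `K_{n_1,…,n_p}` containing a directed
spanning tree equals
`[(N!/(n_1! ⋯ n_p!))/(r_1! ⋯ r_s!)] · (N² − Σ n_i²)/(N(N−1))`,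
where `r_1, …, r_s` are the multiplicities of the distinct sizes among the `n_i`.
(Stated in product form to avoid truncated division.) -/
theorem C_formula (p : ℕ) (n : Fin p → ℕ) (hn : ∀ i, 1 ≤ n i)
    (N : ℕ) (hN : N = ∑ i, n i) (hN2 : 2 ≤ N) :
    C p n * (∏ m ∈ Finset.image n Finset.univ,
        (Finset.univ.filter (fun i : Fin p => n i = m)).card.factorial) *
      (N * (N - 1)) =
    Nat.multinomial Finset.univ n * (N ^ 2 - ∑ i, n i ^ 2) := by
  have h1 := main_count p n hn N hN hN2
  have h2 := goodOrder_card p n N hN ⟨0, by omega⟩ ⟨1, by omega⟩ (by simp)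
  have h3 := Nat.multinomial_spec Finset.univ n
  rw [← hN] at h3
  rw [h1, aut_card, ← h3] at h2
  have hpos : 0 < ∏ i, (n i).factorial := Finset.prod_pos fun i _ => Nat.factorial_pos _
  refine Nat.eq_of_mul_eq_mul_left hpos ?_
  rw [← mul_assoc (∏ i, (n i).factorial) (Nat.multinomial _ _), ← h2]
  ring
end

section
/- For all n_1, n_2 ∈ ℕ, the number of acyclic orientations of the labelled complete bipartite graph K_{n_1,n_2} equals Σ_{m=0}^{min(n_1,n_2)} (m!)² · S(n_1+1, m+1) · S(n_2+1, m+1), where S(r,s) is the Stirling number of the second kind. -/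
/-- The Stirling numbers of the second kind `S(r, s)`: the number of partitions of
an `r`-element set into `s` nonempty blocks, via the standard recurrence
`S(r+1, s+1) = (s+1)·S(r, s+1) + S(r, s)`. -/
def stirling2 : ℕ → ℕ → ℕ
  | 0, 0 => 1
  | 0, _ + 1 => 0
  | _ + 1, 0 => 0
  | r + 1, s + 1 => (s + 1) * stirling2 r (s + 1) + stirling2 r s

/-- Maps to `Fin (m+1)` hitting every nonzero value. -/
def HitMap (α : Type) (m : ℕ) : Type :=
  {p : α → Fin (m + 1) // ∀ j, j ≠ 0 → ∃ a, p a = j}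

noncomputable instance (n m : ℕ) : Fintype (HitMap (Fin n) m) := by
  classical
  unfold HitMap
  infer_instance

/-- The recursive construction of `HitMap`s. -/
def hitStep (n m : ℕ) :
    (Fin (m + 2) × HitMap (Fin n) (m + 1)) ⊕ (Fin (m + 1) × HitMap (Fin n) m) →
      HitMap (Fin (n + 1)) (m + 1)
  | Sum.inl (v, p) => ⟨Fin.cons v p.1, fun j hj => by
      obtain ⟨a, ha⟩ := p.2 j hj
      exact ⟨a.succ, by simpa using ha⟩⟩
  | Sum.inr (v, p) => ⟨Fin.cons v.succ (fun i => v.succ.succAbove (p.1 i)), fun j hj => by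
      by_cases h : j = v.succ
      · exact ⟨0, by simp [h]⟩
      · obtain ⟨k, rfl⟩ := Fin.exists_succAbove_eq h
        have hk : k ≠ 0 := by
          rintro rfl
          exact hj (Fin.succAbove_ne_zero_zero (Fin.succ_ne_zero v))
        obtain ⟨a, ha⟩ := p.2 k hk
        exact ⟨a.succ, by simp [ha]⟩⟩

theorem hitStep_bijective (n m : ℕ) : Function.Bijective (hitStep n m) := by
  constructor
  · rintro (⟨v, p, hp⟩ | ⟨v, p, hp⟩) (⟨w, q, hq⟩ | ⟨w, q, hq⟩) h
    · have h := congrArg Subtype.val h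
      simp only [hitStep] at h
      obtain ⟨h1, h2⟩ := Fin.cons_injective2 h
      subst h1 h2
      rfl
    · have h := congrArg Subtype.val h
      simp only [hitStep] at h
      obtain ⟨h1, h2⟩ := Fin.cons_injective2 h
      obtain ⟨a, ha⟩ := hp w.succ (Fin.succ_ne_zero w)
      rw [h2] at ha
      exact absurd ha (Fin.succAbove_ne _ _)
    · have h := congrArg Subtype.val h
      simp only [hitStep] at h
      obtain ⟨h1, h2⟩ := Fin.cons_injective2 h
      obtain ⟨a, ha⟩ := hq v.succ (Fin.succ_ne_zero v)
      rw [← h2] at ha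
      exact absurd ha (Fin.succAbove_ne _ _)
    · have h := congrArg Subtype.val h
      simp only [hitStep] at h
      obtain ⟨h1, h2⟩ := Fin.cons_injective2 h
      have h1 := Fin.succ_injective _ h1
      subst h1
      have : p = q := by
        funext i
        exact Fin.succAbove_right_injective (congrFun h2 i)
      subst this
      rfl
  · rintro ⟨p, hp⟩
    by_cases h : ∀ j, j ≠ 0 → ∃ a : Fin n, p a.succ = j
    · refine ⟨Sum.inl (p 0, ⟨fun i => p i.succ, h⟩), ?_⟩
      apply Subtype.ext
      simp only [hitStep]
      exact Fin.cons_self_tail p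
    · push Not at h
      obtain ⟨j, hj, hja⟩ := h
      have h0 : p 0 = j := by
        obtain ⟨a, ha⟩ := hp j hj
        rcases Fin.eq_zero_or_eq_succ a with rfl | ⟨b, rfl⟩
        · exact ha
        · exact absurd ha (hja b)
      obtain ⟨v, rfl⟩ := Fin.exists_succ_eq.2 hj
      choose q hq using fun a => Fin.exists_succAbove_eq (hja a)
      refine ⟨Sum.inr (v, ⟨q, ?_⟩), ?_⟩
      · intro k hk
        obtain ⟨a, ha⟩ := hp (v.succ.succAbove k) (Fin.succAbove_ne_zero (Fin.succ_ne_zero v) hk)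
        rcases Fin.eq_zero_or_eq_succ a with rfl | ⟨b, rfl⟩
        · rw [h0] at ha
          exact absurd ha.symm (Fin.succAbove_ne _ _)
        · rw [← hq b] at ha
          exact ⟨b, Fin.succAbove_right_injective ha⟩
      · apply Subtype.ext
        simp only [hitStep, hq]
        rw [← h0]
        exact Fin.cons_self_tail p

theorem stirling2_one (n : ℕ) : stirling2 (n + 1) 1 = 1 := by
  induction n with
  | zero => simp [stirling2]
  | succ n ih => rw [stirling2, ih]; simp [stirling2]

theorem card_hitMap (n m : ℕ) :
    Nat.card (HitMap (Fin n) m) = m.factorial * stirling2 (n + 1) (m + 1) := by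
  induction n generalizing m with
  | zero =>
    cases m with
    | zero =>
      have : Unique (HitMap (Fin 0) 0) :=
        ⟨⟨⟨fun _ => 0, fun j hj => absurd (Fin.ext (by omega)) hj⟩⟩,
          fun p => Subtype.ext (Subsingleton.elim _ _)⟩
      simp [stirling2]
    | succ m =>
      have : IsEmpty (HitMap (Fin 0) (m + 1)) :=
        ⟨fun p => (p.2 1 (by simp)).choose.elim0⟩
      simp [stirling2]
  | succ n ih =>
    cases m with
    | zero =>
      have : Unique (HitMap (Fin (n + 1)) 0) :=
        ⟨⟨⟨fun _ => 0, fun j hj => absurd (Fin.ext (by omega)) hj⟩⟩,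
          fun p => Subtype.ext (funext fun _ => Fin.ext (by omega))⟩
      simp [stirling2_one]
    | succ m =>
      rw [← Nat.card_congr (Equiv.ofBijective _ (hitStep_bijective n m)), Nat.card_sum,
        Nat.card_prod, Nat.card_prod, ih, ih, Nat.card_fin, Nat.card_fin,
        stirling2.eq_4 (n + 1), Nat.factorial_succ]
      ring

theorem HitMap.le {n m : ℕ} (p : HitMap (Fin n) m) : m ≤ n := by
  choose f hf using fun j : Fin m => p.2 j.succ (Fin.succ_ne_zero j)
  have : Function.Injective f := by
    intro i j h
    have := hf i
    rw [h, hf j] at this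
    exact (Fin.succ_injective _ this).symm
  simpa using Fintype.card_le_of_injective f this

theorem HitMap.hit {α : Type} {m : ℕ} (p : HitMap α m) (k : ℕ) (h0 : 0 < k) (hk : k ≤ m) :
    ∃ a, (p.1 a : ℕ) = k := by
  obtain ⟨a, ha⟩ := p.2 ⟨k, by omega⟩ (by
    intro h
    have := congrArg Fin.val h
    simp at this
    omega)
  exact ⟨a, by rw [ha]⟩

theorem HitMap.bd {α : Type} {m : ℕ} (p : HitMap α m) (a : α) : (p.1 a : ℕ) ≤ m := by
  have := (p.1 a).2
  omega

theorem rank_le_of_order {α : Type} {m m' : ℕ} (p : HitMap α m) (p' : HitMap α m')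
    (h0 : ∀ a, (p'.1 a : ℕ) = 0 → (p.1 a : ℕ) = 0)
    (h : ∀ a a', (p'.1 a : ℕ) ≤ p'.1 a' → (p.1 a : ℕ) ≤ p.1 a') :
    ∀ k a, (p.1 a : ℕ) = k → k ≤ p'.1 a := by
  intro k
  induction k with
  | zero => intros; omega
  | succ k ih =>
    intro a ha
    by_cases hk : k = 0
    · have := h0 a
      omega
    · obtain ⟨a', ha'⟩ := p.hit k (by omega) (by have := p.bd a; omega)
      have h1 := ih a' ha'
      have h2 := h a a'
      omega

theorem order_iff {α β : Type} {m : ℕ} (p : HitMap α m) (q : HitMap β m) (a a' : α) :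
    (p.1 a : ℕ) ≤ p.1 a' ↔ ∀ b, m < (p.1 a : ℕ) + q.1 b → m < (p.1 a' : ℕ) + q.1 b := by
  constructor
  · intro h b hb
    omega
  · intro h
    by_contra hc
    have := p.bd a
    obtain ⟨b, hb⟩ := q.hit (m + 1 - p.1 a) (by omega) (by omega)
    have := h b
    omega

theorem zero_iff {α β : Type} {m : ℕ} (p : HitMap α m) (q : HitMap β m) (a : α) :
    (p.1 a : ℕ) = 0 ↔ ∀ b, ¬ m < (p.1 a : ℕ) + q.1 b := by
  constructor
  · intro h b hb
    have := q.bd b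
    omega
  · intro h
    by_contra hc
    have := p.bd a
    obtain ⟨b, hb⟩ := q.hit (m + 1 - p.1 a) (by omega) (by omega)
    have := h b
    omega

theorem val_le_of_rel {α β : Type} {m m' : ℕ} (p : HitMap α m) (q : HitMap β m)
    (p' : HitMap α m') (q' : HitMap β m')
    (h : ∀ a b, m < (p.1 a : ℕ) + q.1 b ↔ m' < (p'.1 a : ℕ) + q'.1 b) (a : α) :
    (p.1 a : ℕ) ≤ p'.1 a := by
  refine rank_le_of_order p p' ?_ ?_ _ a rfl
  · intro a
    rw [zero_iff p q, zero_iff p' q']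
    simp only [h]
    exact id
  · intro a a'
    rw [order_iff p q, order_iff p' q']
    simp only [h]
    exact id

theorem m_le_of_rel {α β : Type} {m m' : ℕ} (p : HitMap α m) (q : HitMap β m)
    (p' : HitMap α m') (q' : HitMap β m')
    (h : ∀ a b, m < (p.1 a : ℕ) + q.1 b ↔ m' < (p'.1 a : ℕ) + q'.1 b) : m ≤ m' := by
  by_cases hm : m = 0
  · omega
  · obtain ⟨a, ha⟩ := p.hit m (by omega) le_rfl
    have := val_le_of_rel p q p' q' h a
    have := p'.bd a
    omega

theorem exists_rank {α β : Type} [Fintype α] [Fintype β] (R : α → β → Prop)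
    (hR : ∀ a a', (∀ b, R a b → R a' b) ∨ (∀ b, R a' b → R a b)) :
    ∃ (m : ℕ) (p : HitMap α m) (q : HitMap β m), ∀ a b, R a b ↔ m < (p.1 a : ℕ) + q.1 b := by
  classical
  let N : α → Finset β := fun a => Finset.univ.filter (R a)
  have hN : ∀ a a', N a ⊆ N a' ∨ N a' ⊆ N a := by
    intro a a'
    rcases hR a a' with h | h
    · left; intro b; simpa [N] using h b
    · right; intro b; simpa [N] using h b
  have hc : ∀ a a', (N a).card ≤ (N a').card → N a ⊆ N a' := by
    intro a a' h
    rcases hN a a' with h' | h'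
    · exact h'
    · exact (Finset.eq_of_subset_of_card_le h' h).symm.subset
  let T : Finset ℕ := (Finset.univ.image fun a => (N a).card).filter (· ≠ 0)
  let m := T.card
  let e : Fin m ≃o T := T.orderIsoOfFin rfl
  have hT : ∀ a, (N a).card ≠ 0 → (N a).card ∈ T := by
    intro a h
    simp only [T, Finset.mem_filter, Finset.mem_image, Finset.mem_univ, true_and]
    exact ⟨⟨a, rfl⟩, h⟩
  let p : α → Fin (m + 1) := fun a =>
    if h : (N a).card ≠ 0 then (e.symm ⟨_, hT a h⟩).succ else 0
  have hp0 : ∀ a, (p a : ℕ) = 0 → N a = ∅ := by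
    intro a h
    by_contra hne
    have hne : (N a).card ≠ 0 := by simpa using hne
    simp only [p, dif_pos hne] at h
    simp at h
  have hple : ∀ a a', (p a : ℕ) ≤ p a' → N a ⊆ N a' := by
    intro a a' h
    by_cases h1 : (N a).card ≠ 0
    · by_cases h2 : (N a').card ≠ 0
      · apply hc
        simp only [p, dif_pos h1, dif_pos h2] at h
        rw [Fin.val_fin_le, Fin.succ_le_succ_iff, e.symm.le_iff_le] at h
        exact h
      · simp only [p, dif_pos h1, dif_neg h2] at h
        simp at h
    · have : N a = ∅ := by simpa using h1
      rw [this]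
      exact Finset.empty_subset _
  let P : HitMap α m := ⟨p, by
    intro j hj
    obtain ⟨i, rfl⟩ := Fin.exists_succ_eq.2 hj
    have := (e i).2
    simp only [T, Finset.mem_filter, Finset.mem_image, Finset.mem_univ, true_and] at this
    obtain ⟨⟨a, ha⟩, hne⟩ := this
    refine ⟨a, ?_⟩
    have hne' : (N a).card ≠ 0 := by rw [ha]; exact hne
    simp only [p, dif_pos hne']
    congr 1
    rw [OrderIso.symm_apply_eq]
    exact Subtype.ext ha⟩
  -- smallest level of a column
  have hq : ∀ b, ∃ k : ℕ, k ≤ m ∧ ∀ a, R a b ↔ m < (p a : ℕ) + k := by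
    intro b
    by_cases hb : ∃ k, ∃ a, R a b ∧ (p a : ℕ) = k
    · obtain ⟨a, ha, hk⟩ := Nat.find_spec hb
      have hmin := fun k => @Nat.find_min' _ _ hb k
      set k := Nat.find hb
      have hk0 : k ≠ 0 := by
        intro h0
        have := hp0 a (by omega)
        have hba : b ∈ N a := by simpa [N] using ha
        rw [this] at hba
        simp at hba
      have hkm : k ≤ m := by have := P.bd a; simp only [P] at this; omega
      refine ⟨m + 1 - k, by omega, ?_⟩
      intro a'
      constructor
      · intro h
        have := hmin _ ⟨a', h, rfl⟩
        omega
      · intro h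
        have hba : b ∈ N a := by simpa [N] using ha
        have := hple a a' (by omega) hba
        simpa [N] using this
    · push Not at hb
      refine ⟨0, by omega, ?_⟩
      intro a
      have := P.bd a
      simp only [P] at this
      constructor
      · intro h
        exact absurd rfl (hb _ a h)
      · intro h
        omega
  choose q hqm hq using hq
  refine ⟨m, P, ⟨fun b => ⟨q b, by have := hqm b; omega⟩, ?_⟩, fun a b => hq b a⟩
  intro j hj
  have hj0 : (j : ℕ) ≠ 0 := fun h => hj (Fin.ext h)
  have hjm := j.2
  obtain ⟨a, ha⟩ := P.hit (m + 1 - j) (by omega) (by omega)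
  change (p a : ℕ) = _ at ha
  suffices h : ∃ b, R a b ∧ ∀ a', (p a' : ℕ) = m - j → 0 < m - (j : ℕ) → ¬ R a' b by
    obtain ⟨b, hb, hb'⟩ := h
    refine ⟨b, Fin.ext ?_⟩
    change q b = j
    have h1 := (hq b a).1 hb
    have h3 := hqm b
    by_cases hz : 0 < m - (j : ℕ)
    · obtain ⟨a', ha'⟩ := P.hit (m - j) hz (by omega)
      change (p a' : ℕ) = _ at ha'
      have h2 := hb' a' ha' hz
      rw [hq] at h2
      omega
    · omega
  by_cases hz : 0 < m - (j : ℕ)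
  · obtain ⟨a', ha'⟩ := P.hit (m - j) hz (by omega)
    change (p a' : ℕ) = _ at ha'
    have hns : ¬ N a ⊆ N a' := by
      intro hs
      have hs2 := hple a' a (by omega)
      have he : N a = N a' := hs.antisymm hs2
      have : p a = p a' := by simp only [p, he]
      rw [this] at ha
      omega
    obtain ⟨b, hb, hb'⟩ := Finset.not_subset.1 hns
    refine ⟨b, by simpa [N] using hb, ?_⟩
    intro a'' ha'' _ hR'
    apply hb'
    apply hple a'' a' (by omega)
    simpa [N] using hR'
  · have : (N a).Nonempty := by
      by_contra hne
      have : (N a).card = 0 := by rw [Finset.card_eq_zero]; exact Finset.not_nonempty_iff_eq_empty.1 hne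
      have : p a = 0 := by simp only [p]; rw [dif_neg (by simpa using this)]
      rw [this] at ha
      simp at ha
      omega
    obtain ⟨b, hb⟩ := this
    exact ⟨b, by simpa [N] using hb, fun _ _ h => absurd h hz⟩

/-- The potential attached to a pair of maps. -/
def pot {n₁ n₂ m : ℕ} (p : HitMap (Fin n₁) m) (q : HitMap (Fin n₂) m) : Fin n₁ ⊕ Fin n₂ → ℕ
  | Sum.inl a => 2 * p.1 a
  | Sum.inr b => 2 * (m - q.1 b) + 1

/-- The type of acyclic orientations. -/
abbrev AcycOr (n₁ n₂ : ℕ) : Type :=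
  {o : (Fin n₁ ⊕ Fin n₂) → (Fin n₁ ⊕ Fin n₂) → Prop //
        (∀ u v, o u v → u.isLeft ≠ v.isLeft) ∧
        (∀ u v, u.isLeft ≠ v.isLeft → Xor' (o u v) (o v u)) ∧
        Irreflexive (Relation.TransGen o)}

/-- The orientation attached to a pair of maps. -/
def toOr (n₁ n₂ : ℕ) :
    (Σ m : Fin (min n₁ n₂ + 1), HitMap (Fin n₁) m × HitMap (Fin n₂) m) → AcycOr n₁ n₂ :=
  fun x => ⟨fun u v => u.isLeft ≠ v.isLeft ∧ pot x.2.1 x.2.2 v < pot x.2.1 x.2.2 u, by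
    refine ⟨fun u v h => h.1, ?_, ?_⟩
    · intro u v h
      have hne : pot x.2.1 x.2.2 v ≠ pot x.2.1 x.2.2 u := by
        rcases u with a | b <;> rcases v with c | d <;> simp [pot] at h ⊢ <;> omega
      rcases lt_or_gt_of_ne hne with h1 | h1
      · exact Or.inl ⟨⟨h, h1⟩, fun h2 => by omega⟩
      · exact Or.inr ⟨⟨h.symm, h1⟩, fun h2 => by omega⟩
    · intro u hu
      have key : ∀ v w, Relation.TransGen (fun u v : Fin n₁ ⊕ Fin n₂ => u.isLeft ≠ v.isLeft ∧
          pot x.2.1 x.2.2 v < pot x.2.1 x.2.2 u) v w →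
          pot x.2.1 x.2.2 w < pot x.2.1 x.2.2 v := by
        intro v w h
        induction h with
        | single h => exact h.2
        | tail _ h ih => exact h.2.trans ih
      exact lt_irrefl _ (key u u hu)⟩

theorem toOr_apply {n₁ n₂ : ℕ} (m : Fin (min n₁ n₂ + 1)) (p : HitMap (Fin n₁) m)
    (q : HitMap (Fin n₂) m) (a : Fin n₁) (b : Fin n₂) :
    (toOr n₁ n₂ ⟨m, p, q⟩).1 (Sum.inl a) (Sum.inr b) ↔ (m : ℕ) < (p.1 a : ℕ) + q.1 b := by
  have := q.bd b
  simp only [toOr, pot]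
  simp
  omega

theorem AcycOr.ext' {n₁ n₂ : ℕ} (o o' : AcycOr n₁ n₂)
    (h : ∀ a b, o.1 (Sum.inl a) (Sum.inr b) ↔ o'.1 (Sum.inl a) (Sum.inr b)) : o = o' := by
  obtain ⟨o, h1, h2, h3⟩ := o
  obtain ⟨o', h1', h2', h3'⟩ := o'
  apply Subtype.ext
  funext u v
  apply propext
  simp only at h ⊢
  rcases u with a | b <;> rcases v with c | d
  · exact ⟨fun k => (h1 _ _ k rfl).elim, fun k => (h1' _ _ k rfl).elim⟩
  · exact h a d
  · have e1 := h2 (Sum.inl c) (Sum.inr b) (by simp)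
    have e2 := h2' (Sum.inl c) (Sum.inr b) (by simp)
    have e3 := h c b
    unfold Xor' Xor at e1 e2
    tauto
  · exact ⟨fun k => (h1 _ _ k rfl).elim, fun k => (h1' _ _ k rfl).elim⟩

theorem toOr_bijective (n₁ n₂ : ℕ) : Function.Bijective (toOr n₁ n₂) := by
  constructor
  · rintro ⟨⟨m, hm⟩, p, q⟩ ⟨⟨m', hm'⟩, p', q'⟩ h
    have hrel : ∀ a b, m < (p.1 a : ℕ) + q.1 b ↔ m' < (p'.1 a : ℕ) + q'.1 b := by
      intro a b
      have e1 := toOr_apply ⟨m, hm⟩ p q a b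
      have e2 := toOr_apply ⟨m', hm'⟩ p' q' a b
      rw [h] at e1
      exact e1.symm.trans e2
    have hmm : m = m' := le_antisymm (m_le_of_rel p q p' q' hrel)
      (m_le_of_rel p' q' p q fun a b => (hrel a b).symm)
    subst hmm
    have hp : p = p' := Subtype.ext <| funext fun a => Fin.ext <| le_antisymm
      (val_le_of_rel p q p' q' hrel a) (val_le_of_rel p' q' p q (fun a b => (hrel a b).symm) a)
    have hrel' : ∀ b a, m < (q.1 b : ℕ) + p.1 a ↔ m < (q'.1 b : ℕ) + p'.1 a := by
      intro b a
      have := hrel a b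
      omega
    have hq : q = q' := Subtype.ext <| funext fun b => Fin.ext <| le_antisymm
      (val_le_of_rel q p q' p' hrel' b)
      (val_le_of_rel q' p' q p (fun a b => (hrel' a b).symm) b)
    subst hp hq
    rfl
  · intro o
    obtain ⟨m, p, q, h⟩ := exists_rank (fun a b => o.1 (Sum.inl a) (Sum.inr b)) (by
      intro a a'
      by_contra hc
      push Not at hc
      obtain ⟨⟨b, hb, hb'⟩, ⟨c, hcc, hc'⟩⟩ := hc
      have e1 : o.1 (Sum.inr b) (Sum.inl a') := by
        have := o.2.2.1 (Sum.inl a') (Sum.inr b) (by simp)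
        unfold Xor' Xor at this
        tauto
      have e2 : o.1 (Sum.inr c) (Sum.inl a) := by
        have := o.2.2.1 (Sum.inl a) (Sum.inr c) (by simp)
        unfold Xor' Xor at this
        tauto
      have hirr := o.2.2.2
      exact hirr (Sum.inl a)
        ((((Relation.TransGen.single hb).tail e1).tail hcc).tail e2))
    have hm : m < min n₁ n₂ + 1 := by
      have := p.le
      have := q.le
      omega
    refine ⟨⟨⟨m, hm⟩, p, q⟩, ?_⟩
    apply AcycOr.ext'
    intro a b
    rw [toOr_apply]
    exact (h a b).symm

/-- The number of acyclic orientations of the labelled complete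
bipartite graph `K_{n_1,n_2}` (the poly-Bernoulli number `B_{n_1,n_2}`) equals
`Σ_{m=0}^{min(n_1,n_2)} (m!)² · S(n_1+1, m+1) · S(n_2+1, m+1)`. -/
theorem card_acyclicOrientations_completeBipartite (n₁ n₂ : ℕ) :
    Nat.card {o : (Fin n₁ ⊕ Fin n₂) → (Fin n₁ ⊕ Fin n₂) → Prop //
        (∀ u v, o u v → u.isLeft ≠ v.isLeft) ∧
        (∀ u v, u.isLeft ≠ v.isLeft → Xor' (o u v) (o v u)) ∧
        Irreflexive (Relation.TransGen o)} =
    ∑ m ∈ Finset.range (min n₁ n₂ + 1),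
      m.factorial ^ 2 * stirling2 (n₁ + 1) (m + 1) * stirling2 (n₂ + 1) (m + 1) := by
  change Nat.card (AcycOr n₁ n₂) = _
  rw [← Nat.card_congr (Equiv.ofBijective _ (toOr_bijective n₁ n₂)), Nat.card_sigma,
    Fin.sum_univ_eq_sum_range (fun m => Nat.card (HitMap (Fin n₁) m × HitMap (Fin n₂) m))]
  refine Finset.sum_congr rfl fun m _ => ?_
  rw [Nat.card_prod, card_hitMap, card_hitMap]
  ring
end

section
/- For all positive integers k_1,…,k_p, the number X_{k_1,…,k_p} of Smirnov words with letter counts k_1,…,k_p satisfies, as an identity of integers: X_{k_1,…,k_p} = (−1)^{k_1+…+k_p} · Σ_{r_1=1}^{k_1} ⋯ Σ_{r_p=1}^{k_p} ((r_1+…+r_p)! / (r_1!⋯r_p!)) · ∏_{i=1}^{p} (−1)^{r_i} · C(k_i − 1, r_i − 1). -/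
/-- `smirnovCount k` is the number of Smirnov words over the alphabet `Fin p`
with exactly `k i` occurrences of each letter `i`, i.e. words in which no two
consecutive letters are equal. -/
noncomputable def smirnovCount {p : ℕ} (k : Fin p → ℕ) : ℕ :=
  Nat.card {w : List (Fin p) //
    List.Chain' (· ≠ ·) w ∧ ∀ i : Fin p, w.count i = k i}

namespace Smirnov

/-- The single-letter signed coefficient. -/
def B : ℕ → ℕ → ℤ
  | 0, 0 => 1
  | 0, _ + 1 => 0
  | _ + 1, 0 => 0
  | k + 1, r + 1 => (-1) ^ (k + r) * (k.choose r : ℤ)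

lemma B_rec (k r : ℕ) : B (k + 1) (r + 1) + B k (r + 1) = B k r := by
  rcases k with _ | k <;> rcases r with _ | r
  · simp [B]
  · simp [B]
  · simp [B, pow_succ]
  · simp only [B, Nat.choose_succ_succ]
    push_cast
    ring

lemma B_zero_of_lt {k r : ℕ} (h : k < r) : B k r = 0 := by
  rcases k with _ | k <;> rcases r with _ | r
  · omega
  · simp [B]
  · omega
  · simp [B, Nat.choose_eq_zero_of_lt (show k < r by omega)]

lemma B_k_zero (k : ℕ) : B k 0 = if k = 0 then 1 else 0 := by
  cases k <;> simp [B]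

lemma B_pos {k r : ℕ} (hk : 1 ≤ k) (hr : 1 ≤ r) :
    B k r = (-1) ^ k * ((-1) ^ r * ((k - 1).choose (r - 1) : ℤ)) := by
  rcases k with _ | k <;> rcases r with _ | r
  · omega
  · omega
  · omega
  · simp only [B, Nat.add_sub_cancel]; ring

variable {p : ℕ}

/-- Number of words with first letter `c` and content `r`. -/
noncomputable def Mc (c : Fin p) (r : Fin p → ℕ) : ℕ :=
  if r c = 0 then 0 else Nat.multinomial Finset.univ (r - Pi.single c 1)

lemma Mc_add (c : Fin p) (s : Fin p → ℕ) :
    Mc c (s + Pi.single c 1) = Nat.multinomial Finset.univ s := by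
  simp [Mc]

lemma M_mul (r : Fin p → ℕ) :
    (∏ i, (r i).factorial) * Nat.multinomial Finset.univ r = (∑ i, r i).factorial :=
  Nat.multinomial_spec _ _

lemma sum_add_single (s : Fin p → ℕ) (c : Fin p) :
    ∑ i, (s + Pi.single c 1 : Fin p → ℕ) i = ∑ i, s i + 1 := by
  simp [Finset.sum_add_distrib]

lemma exists_add {r : Fin p → ℕ} {c : Fin p} (h : r c ≠ 0) :
    ∃ s : Fin p → ℕ, r = s + Pi.single c 1 := by
  refine ⟨r - Pi.single c 1, ?_⟩
  ext i
  by_cases hi : i = c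
  · subst hi; simp; omega
  · simp [hi]

lemma prod_fact_add (s : Fin p → ℕ) (c : Fin p) :
    ∏ i, ((s + Pi.single c 1 : Fin p → ℕ) i).factorial = (s c + 1) * ∏ i, (s i).factorial := by
  rw [← Finset.mul_prod_erase _ _ (Finset.mem_univ c),
    ← Finset.mul_prod_erase (a := c) _ (fun i => (s i).factorial) (Finset.mem_univ c)]
  rw [← mul_assoc]
  congr 1
  · simp [Nat.factorial_succ]
  · refine Finset.prod_congr rfl fun i hi => ?_
    simp [Finset.ne_of_mem_erase hi]

lemma Mc_mul (c : Fin p) (r : Fin p → ℕ) :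
    (∏ i, (r i).factorial) * Mc c r = r c * (∑ i, r i - 1).factorial := by
  by_cases h : r c = 0
  · simp [Mc, h]
  · obtain ⟨s, rfl⟩ := exists_add h
    rw [Mc_add, prod_fact_add, sum_add_single, mul_assoc, M_mul]
    simp

lemma M_rec (r : Fin p → ℕ) :
    Nat.multinomial Finset.univ r = (if r = 0 then 1 else 0) + ∑ c, Mc c r := by
  by_cases h : r = 0
  · subst h
    simp [Mc, Nat.multinomial]
  · have hpos : 0 < ∏ i, (r i).factorial := Finset.prod_pos fun i _ => Nat.factorial_pos _
    apply Nat.eq_of_mul_eq_mul_left hpos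
    rw [if_neg h, zero_add, M_mul, Finset.mul_sum]
    simp_rw [Mc_mul]
    rw [← Finset.sum_mul, Nat.mul_factorial_pred]
    intro h0
    apply h
    ext i
    simpa using (Finset.sum_eq_zero_iff.1 h0) i (Finset.mem_univ i)

/-- box -/
def box (p N : ℕ) : Finset (Fin p → ℕ) := Fintype.piFinset fun _ => Finset.range N

/-- The signed sum. -/
noncomputable def F (N : ℕ) (k : Fin p → ℕ) : ℤ :=
  ∑ r ∈ box p N, (Nat.multinomial Finset.univ r : ℤ) * ∏ i, B (k i) (r i)

/-- The signed sum, first letter `c`. -/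
noncomputable def A (N : ℕ) (c : Fin p) (k : Fin p → ℕ) : ℤ :=
  ∑ r ∈ box p N, (Mc c r : ℤ) * ∏ i, B (k i) (r i)

lemma F_eq (N : ℕ) (hN : 0 < N) (k : Fin p → ℕ) :
    F N k = (if k = 0 then 1 else 0) + ∑ c, A N c k := by
  unfold F A
  rw [Finset.sum_comm, ← Finset.sum_congr rfl fun r _ => Finset.sum_mul ..]
  have : ∀ r : Fin p → ℕ, (Nat.multinomial Finset.univ r : ℤ) * ∏ i, B (k i) (r i)
     = (if r = 0 then (if k = 0 then 1 else 0) else 0) +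
       (∑ c, (Mc c r : ℤ)) * ∏ i, B (k i) (r i) := by
    intro r
    rw [M_rec]
    push_cast
    rw [add_mul]
    congr 1
    by_cases h : r = 0
    · subst h
      simp only [if_true, one_mul, Pi.zero_apply, B_k_zero]
      by_cases hk : k = 0
      · simp [hk]
      · rw [if_neg hk]
        obtain ⟨i, hi⟩ := Function.ne_iff.1 hk
        exact Finset.prod_eq_zero (Finset.mem_univ i) (if_neg hi)
    · simp [h]
  simp_rw [this]
  rw [Finset.sum_add_distrib, Finset.sum_ite_eq', if_pos]
  simp [box, hN]

lemma A_zero (N : ℕ) (c : Fin p) (k : Fin p → ℕ) (h : k c = 0) : A N c k = 0 := by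
  refine Finset.sum_eq_zero fun r _ => ?_
  by_cases hr : r c = 0
  · simp [Mc, hr]
  · rw [Finset.prod_eq_zero (Finset.mem_univ c), mul_zero]
    rw [h]; exact B_zero_of_lt (by omega)

lemma prod_split (c : Fin p) (f : Fin p → ℤ) :
    ∏ i, f i = f c * ∏ i ∈ Finset.univ.erase c, f i :=
  (Finset.mul_prod_erase _ _ (Finset.mem_univ c)).symm

lemma prod_B_rec_aux (c : Fin p) (k s k' s' : Fin p → ℕ) (hk : k' c = k c + 1)
    (hs : s' c = s c + 1) (hk' : ∀ i, i ≠ c → k' i = k i) (hs' : ∀ i, i ≠ c → s' i = s i) :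
    ∏ i, B (k' i) (s' i) + ∏ i, B (k i) (s' i) = ∏ i, B (k i) (s i) := by
  rw [prod_split c (fun i => B (k' i) (s' i)), prod_split c (fun i => B (k i) (s' i)),
    prod_split c (fun i => B (k i) (s i))]
  have h1 : ∏ i ∈ Finset.univ.erase c, B (k' i) (s' i)
      = ∏ i ∈ Finset.univ.erase c, B (k i) (s i) :=
    Finset.prod_congr rfl fun i hi => by
      rw [hk' i (Finset.ne_of_mem_erase hi), hs' i (Finset.ne_of_mem_erase hi)]
  have h2 : ∏ i ∈ Finset.univ.erase c, B (k i) (s' i)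
      = ∏ i ∈ Finset.univ.erase c, B (k i) (s i) :=
    Finset.prod_congr rfl fun i hi => by rw [hs' i (Finset.ne_of_mem_erase hi)]
  rw [h1, h2, ← add_mul, hk, hs, B_rec]

lemma prod_B_rec (c : Fin p) (k s : Fin p → ℕ) :
    ∏ i, B ((k + Pi.single c 1 : Fin p → ℕ) i) ((s + Pi.single c 1 : Fin p → ℕ) i)
      + ∏ i, B (k i) ((s + Pi.single c 1 : Fin p → ℕ) i) = ∏ i, B (k i) (s i) :=
  prod_B_rec_aux c k s _ _ (by simp) (by simp) (fun i hi => by simp [hi])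
    (fun i hi => by simp [hi])

lemma A_rec (N : ℕ) (c : Fin p) (k : Fin p → ℕ) (hk : k c + 1 < N) :
    A N c (k + Pi.single c 1) + A N c k = F N k := by
  unfold A F
  rw [← Finset.sum_add_distrib]
  simp_rw [← mul_add]
  symm
  refine Finset.sum_bij_ne_zero (fun s _ _ => s + Pi.single c 1) ?_ ?_ ?_ ?_
  · intro s hs h0
    simp only [box, Fintype.mem_piFinset, Finset.mem_range] at hs ⊢
    intro i
    by_cases hi : i = c
    · subst hi
      have : ¬ k i < s i := by
        intro hlt
        apply h0
        rw [Finset.prod_eq_zero (Finset.mem_univ i), mul_zero]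
        exact B_zero_of_lt hlt
      simp; omega
    · simpa [hi] using hs i
  · intro a _ _ b _ _ hab
    exact add_right_cancel hab
  · intro r hr h0
    have hc : r c ≠ 0 := by
      intro hc
      apply h0
      simp [Mc, hc]
    obtain ⟨s, rfl⟩ := exists_add hc
    refine ⟨s, ?_, ?_, rfl⟩
    · simp only [box, Fintype.mem_piFinset, Finset.mem_range] at hr ⊢
      intro i
      exact lt_of_le_of_lt (by simp) (hr i)
    · rwa [Mc_add, prod_B_rec] at h0
  · intro s _ _
    rw [Mc_add, prod_B_rec]

/-- Smirnov words. -/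
def W (k : Fin p → ℕ) : Set (List (Fin p)) :=
  {w | List.IsChain (· ≠ ·) w ∧ ∀ i : Fin p, w.count i = k i}

/-- Smirnov words with given head. -/
def Wh (o : Option (Fin p)) (k : Fin p → ℕ) : Set (List (Fin p)) :=
  {w | w ∈ W k ∧ w.head? = o}

lemma W_finite (k : Fin p → ℕ) : (W k).Finite := by
  refine (List.finite_length_eq (Fin p) (∑ i, k i)).subset ?_
  rintro w ⟨_, hw⟩
  have := Multiset.toFinset_sum_count_eq (w : Multiset (Fin p))
  simp only [Set.mem_setOf_eq]
  simp_rw [← hw]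
  have h2 := Multiset.sum_count_eq_card (s := Finset.univ) (m := (w : Multiset (Fin p)))
    (fun a _ => Finset.mem_univ a)
  simpa using h2.symm

lemma Wh_finite (o : Option (Fin p)) (k : Fin p → ℕ) : (Wh o k).Finite :=
  (W_finite k).subset fun _ h => h.1

lemma Wh_none (k : Fin p → ℕ) : (Wh none k).ncard = if k = 0 then 1 else 0 := by
  split_ifs with h
  · subst h
    rw [Set.ncard_eq_one]
    refine ⟨[], ?_⟩
    ext w
    simp only [Wh, W, Set.mem_setOf_eq, List.head?_eq_none_iff, Set.mem_singleton_iff]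
    constructor
    · exact fun h => h.2
    · rintro rfl; simp
  · rw [Set.ncard_eq_zero (Wh_finite _ _), Set.eq_empty_iff_forall_notMem]
    rintro w ⟨⟨_, hw⟩, hn⟩
    rw [List.head?_eq_none_iff] at hn
    subst hn
    apply h
    ext i
    simp [← hw i]

lemma W_card (k : Fin p → ℕ) :
    (W k).ncard = (if k = 0 then 1 else 0) + ∑ c, (Wh (some c) k).ncard := by
  classical
  rw [← Wh_none, ← Fintype.sum_option (fun o => (Wh o k).ncard),
    Set.ncard_eq_toFinset_card _ (W_finite k),
    Finset.card_eq_sum_card_fiberwise (f := List.head?) (t := Finset.univ) (by simp)]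
  refine Finset.sum_congr rfl fun o _ => ?_
  rw [← Set.ncard_coe_finset]
  congr 1
  ext w
  simp [Wh]

lemma Wh_zero (c : Fin p) (k : Fin p → ℕ) (h : k c = 0) : (Wh (some c) k).ncard = 0 := by
  rw [Set.ncard_eq_zero (Wh_finite _ _), Set.eq_empty_iff_forall_notMem]
  rintro w ⟨⟨_, hw⟩, hn⟩
  have := List.mem_of_mem_head? (by simpa using hn : c ∈ w.head?)
  rw [← List.count_pos_iff, hw] at this
  omega

lemma Wh_rec (c : Fin p) (k : Fin p → ℕ) :
    (Wh (some c) (k + Pi.single c 1)).ncard + (Wh (some c) k).ncard = (W k).ncard := by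
  have : Wh (some c) (k + Pi.single c 1) = Set.image (List.cons c) (W k \ Wh (some c) k) := by
    ext w
    simp only [Set.mem_image, Set.mem_diff]
    constructor
    · rintro ⟨⟨h1, h2⟩, h3⟩
      rcases w with _ | ⟨d, w⟩
      · simp at h3
      · simp only [List.head?_cons, Option.some.injEq] at h3
        subst h3
        rw [List.isChain_cons] at h1
        refine ⟨w, ⟨⟨h1.2, fun i => ?_⟩, fun h => ?_⟩, rfl⟩
        · have := h2 i
          by_cases hi : i = d
          · subst hi; simpa using this
          · simpa [hi, List.count_cons, Ne.symm hi, eq_comm] using this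
        · exact h1.1 d h.2 rfl
    · rintro ⟨v, ⟨hv, hn⟩, rfl⟩
      refine ⟨⟨?_, fun i => ?_⟩, rfl⟩
      · rw [List.isChain_cons]
        refine ⟨?_, hv.1⟩
        rintro y hy rfl
        exact hn ⟨hv, hy⟩
      · have := hv.2 i
        by_cases hi : i = c
        · subst hi; simpa using this
        · simpa [hi, List.count_cons, Ne.symm hi, eq_comm] using this
  rw [this, Set.ncard_image_of_injective _ List.cons_injective]
  exact Set.ncard_sdiff_add_ncard_of_subset (fun _ h => h.1) (W_finite k)

lemma Wh_eq_A (N : ℕ) : ∀ (n : ℕ) (k : Fin p → ℕ), ∑ i, k i = n → n < N →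
    ∀ c, ((Wh (some c) k).ncard : ℤ) = A N c k := by
  intro n
  induction n with
  | zero =>
    intro k hk _ c
    have : k c = 0 := (Finset.sum_eq_zero_iff.1 hk) c (Finset.mem_univ c)
    rw [Wh_zero c k this, A_zero N c k this]; rfl
  | succ n ih =>
    intro k hk hn c
    by_cases h : k c = 0
    · rw [Wh_zero c k h, A_zero N c k h]; rfl
    · obtain ⟨s, rfl⟩ := exists_add h
      rw [sum_add_single] at hk
      have hs : ∑ i, s i = n := by omega
      have hc : s c ≤ ∑ i, s i := Finset.single_le_sum (fun _ _ => Nat.zero_le _) (Finset.mem_univ c)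
      have h1 := Wh_rec c s
      have h2 := A_rec N c s (by omega)
      have h3 := ih s hs (by omega)
      have h4 : ((W s).ncard : ℤ) = F N s := by
        rw [W_card, F_eq N (by omega)]
        push_cast
        simp_rw [h3]
      have h5 := h3 c
      zify at h1
      linarith

lemma W_eq_F (N : ℕ) (k : Fin p → ℕ) (hN : ∑ i, k i < N) : ((W k).ncard : ℤ) = F N k := by
  rw [W_card, F_eq N (by omega)]
  push_cast
  simp_rw [Wh_eq_A N _ k rfl hN]

end Smirnov

/-- For positive letter counts `k_1, …, k_p`, the number of
Smirnov words satisfies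
`X_k = (−1)^{k_1+…+k_p} Σ_{r_1=1}^{k_1} ⋯ Σ_{r_p=1}^{k_p}
  ((r_1+…+r_p)!/(r_1!⋯r_p!)) ∏_i (−1)^{r_i} C(k_i−1, r_i−1)`. -/
theorem smirnovCount_formula (p : ℕ) (k : Fin p → ℕ) (hk : ∀ i, 1 ≤ k i) :
    (smirnovCount k : ℤ) =
      (-1 : ℤ) ^ (∑ i, k i) *
        ∑ r ∈ Fintype.piFinset (fun i : Fin p => Finset.Icc 1 (k i)),
          (Nat.multinomial Finset.univ r : ℤ) *
            ∏ i : Fin p, (-1 : ℤ) ^ (r i) * ((k i - 1).choose (r i - 1) : ℤ) := by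
  have h1 : smirnovCount k = (Smirnov.W k).ncard := rfl
  rw [h1, Smirnov.W_eq_F (∑ i, k i + 1) k (by omega), Finset.mul_sum]
  unfold Smirnov.F
  symm
  refine Finset.sum_subset_zero_on_sdiff ?_ ?_ ?_
  · intro r hr
    simp only [Smirnov.box, Fintype.mem_piFinset, Finset.mem_range, Finset.mem_Icc] at hr ⊢
    intro i
    have hc : k i ≤ ∑ i, k i :=
      Finset.single_le_sum (fun _ _ => Nat.zero_le _) (Finset.mem_univ i)
    have := hr i
    omega
  · intro r hr
    simp only [Finset.mem_sdiff, Fintype.mem_piFinset, Finset.mem_Icc, not_forall] at hr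
    obtain ⟨_, i, hi⟩ := hr
    rw [Finset.prod_eq_zero (Finset.mem_univ i), mul_zero]
    have := hk i
    by_cases h0 : r i = 0
    · rw [h0, Smirnov.B_k_zero, if_neg (by omega)]
    · exact Smirnov.B_zero_of_lt (by omega)
  · intro r hr
    simp only [Fintype.mem_piFinset, Finset.mem_Icc] at hr
    rw [Finset.prod_congr rfl fun i _ => Smirnov.B_pos (hk i) (hr i).1,
      Finset.prod_mul_distrib (f := fun i => (-1 : ℤ) ^ k i), Finset.prod_pow_eq_pow_sum]
    ring
end

section
/- For every j ∈ Fin p and every (k_1,…,k_p) ∈ ℕ^p with k_j ≥ 1, the numbers X^{(i)} of Smirnov words with prescribed first letter satisfy X^{(j)}_{k_1,…,k_p} = (Σ_{i=1}^{p} X^{(i)}_{k_1,…,k_j−1,…,k_p}) − X^{(j)}_{k_1,…,k_j−1,…,k_p} + [((k_1,…,k_p) = e_j)], where e_j is the j-th standard unit vector and the bracket is 1 if the condition holds and 0 otherwise. -/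
/-- `smirnovFirstCount i k` is the number of Smirnov words over the alphabet
`Fin p` (words with no two equal consecutive letters) with exactly `k m`
occurrences of each letter `m` and whose first letter is `i`.  (The empty word
never counts, since its first letter is undefined.) -/
noncomputable def smirnovFirstCount {p : ℕ} (i : Fin p) (k : Fin p → ℕ) : ℕ :=
  Nat.card {w : List (Fin p) //
    List.Chain' (· ≠ ·) w ∧ (∀ m : Fin p, w.count m = k m) ∧ w.head? = some i}

/-- Smirnov words with given content. -/
def smW {p : ℕ} (k : Fin p → ℕ) : Set (List (Fin p)) :=
  {w | List.IsChain (· ≠ ·) w ∧ (∀ m : Fin p, w.count m = k m)}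

theorem smW_finite {p : ℕ} (k : Fin p → ℕ) : (smW k).Finite := by
  apply (List.finite_length_eq (Fin p) (∑ m, k m)).subset
  rintro w ⟨-, h⟩
  simp only [Set.mem_ofPred_eq]
  rw [← Finset.sum_congr rfl (fun m _ => h m)]
  have := Multiset.sum_count_eq_card (s := Finset.univ) (m := (w : Multiset (Fin p))) (by simp)
  simpa using this.symm

theorem smFC_eq {p : ℕ} (i : Fin p) (k : Fin p → ℕ) :
    smirnovFirstCount i k = ((smW_finite k).toFinset.filter (fun w => w.head? = some i)).card := by
  unfold smirnovFirstCount
  apply Nat.subtype_card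
  intro w
  simp [smW, and_assoc]
  intros
  exact Iff.rfl

/-- For `j : Fin p` and `k : Fin p → ℕ` with `k j ≥ 1`, the
Smirnov-word counts with prescribed first letter satisfy
`X^{(j)}_k = (Σ_i X^{(i)}_{k − e_j}) − X^{(j)}_{k − e_j} + [k = e_j]`. -/
theorem smirnovFirstCount_recurrence (p : ℕ) (j : Fin p) (k : Fin p → ℕ)
    (hkj : 1 ≤ k j) :
    (smirnovFirstCount j k : ℤ) =
      (∑ i : Fin p, (smirnovFirstCount i (Function.update k j (k j - 1)) : ℤ)) -
        (smirnovFirstCount j (Function.update k j (k j - 1)) : ℤ) +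
        (if k = Pi.single j 1 then 1 else 0) := by
  set k' := Function.update k j (k j - 1) with hk'
  set T := (smW_finite k').toFinset with hT
  have h1 : T.card = ∑ o : Option (Fin p), (T.filter (fun w => w.head? = o)).card :=
    Finset.card_eq_sum_card_fiberwise (fun _ _ => Finset.mem_coe.2 (Finset.mem_univ _))
  have h2 : (T.filter (fun w => w.head? = none)).card = if k = Pi.single j 1 then 1 else 0 := by
    split_ifs with h
    · rw [Finset.card_eq_one]
      refine ⟨[], ?_⟩
      ext w
      simp only [Finset.mem_filter, hT, Set.Finite.mem_toFinset, smW, Set.mem_ofPred_eq,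
        List.head?_eq_none_iff, Finset.mem_singleton]
      refine ⟨fun h => h.2, ?_⟩
      rintro rfl
      refine ⟨⟨by simp, fun m => ?_⟩, rfl⟩
      by_cases hm : m = j
      · subst hm; simp [hk', h]
      · simp [hk', h, hm]
    · rw [Finset.card_eq_zero, Finset.filter_eq_empty_iff]
      intro w hw hn
      rw [List.head?_eq_none_iff] at hn
      subst hn
      simp only [hT, Set.Finite.mem_toFinset, smW, Set.mem_ofPred_eq] at hw
      apply h
      ext m
      have := hw.2 m
      by_cases hm : m = j
      · subst hm; simp [hk'] at this ⊢; omega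
      · simp [hk', hm] at this ⊢; omega
  have h3 : smirnovFirstCount j k = (T.filter (fun w => ¬ w.head? = some j)).card := by
    rw [smFC_eq]
    symm
    apply Finset.card_bij (fun w _ => j :: w)
    · intro w hw
      simp only [Finset.mem_filter, hT, Set.Finite.mem_toFinset, smW, Set.mem_ofPred_eq] at hw ⊢
      obtain ⟨⟨hc, hm⟩, hh⟩ := hw
      refine ⟨⟨?_, fun m => ?_⟩, rfl⟩
      · rw [List.isChain_cons]
        refine ⟨?_, hc⟩
        rintro y hy rfl
        exact hh hy
      · rw [List.count_cons, hm]
        by_cases h : m = j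
        · subst h; simp [hk']; omega
        · simp [hk', h, Ne.symm h]
    · intro a _ b _ h
      simpa using h
    · intro w hw
      simp only [Finset.mem_filter, Set.Finite.mem_toFinset, smW, Set.mem_ofPred_eq] at hw
      obtain ⟨⟨hc, hm⟩, hh⟩ := hw
      cases w with
      | nil => simp at hh
      | cons a w =>
        simp only [List.head?_cons, Option.some.injEq] at hh
        subst hh
        rw [List.isChain_cons] at hc
        refine ⟨w, ?_, rfl⟩
        simp only [Finset.mem_filter, hT, Set.Finite.mem_toFinset, smW, Set.mem_ofPred_eq]
        refine ⟨⟨hc.2, fun m => ?_⟩, fun h => hc.1 a h rfl⟩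
        have := hm m
        rw [List.count_cons] at this
        by_cases h : m = a
        · subst h; simp [hk'] at this ⊢; omega
        · simpa [hk', h, Ne.symm h] using this
  have h4 := Finset.card_filter_add_card_filter_not (s := T) (fun w => w.head? = some j)
  rw [Fintype.sum_option, h2] at h1
  rw [h3]
  simp only [smFC_eq]
  rw [← hT]
  have h5 : ((if k = Pi.single j 1 then 1 else 0 : ℕ) : ℤ) = if k = Pi.single j 1 then 1 else 0 := by
    split_ifs <;> rfl
  rw [← h5, ← Nat.cast_sum]
  omega
end

section
/- For every (k_1,…,k_p) ∈ ℕ^p, the number X_{k_1,…,k_p} of Smirnov words with letter counts k_1,…,k_p is positive if and only if 2 · max{k_1,…,k_p} ≤ 1 + (k_1 + k_2 + … + k_p). -/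
theorem smirnov_forward {p : ℕ} (a : Fin p) (w : List (Fin p)) (h : List.IsChain (· ≠ ·) w) :
    2 * w.count a ≤ w.length + (if w.head? = some a then 1 else 0) := by
  induction w with
  | nil => simp
  | cons b t ih =>
    rw [List.isChain_cons] at h
    have ih' := ih h.2
    by_cases hb : b = a
    · subst hb
      have : t.head? ≠ some b := fun hh => h.1 b hh rfl
      simp [this] at ih' ⊢
      omega
    · rw [List.count_cons_of_ne hb]
      simp [hb]
      split_ifs at ih' <;> omega

theorem smirnov_length {p : ℕ} (w : List (Fin p)) : w.length = ∑ i, w.count i := by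
  induction w with
  | nil => simp
  | cons b t ih =>
    simp [List.count_cons, Finset.sum_add_distrib, ih]

theorem smirnov_backward {p : ℕ} (n : ℕ) : ∀ (k : Fin p → ℕ) (b : Option (Fin p)),
    ∑ i, k i = n → (∀ i, 2 * k i ≤ n + 1) → (∀ i, b = some i → 2 * k i ≤ n) →
    ∃ w : List (Fin p), List.IsChain (· ≠ ·) w ∧ (∀ i, w.count i = k i) ∧
      ∀ i, b = some i → w.head? ≠ some i := by
  induction n with
  | zero =>
    intro k b hs h1 h2
    refine ⟨[], by simp, fun i => ?_, by simp⟩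
    have := h1 i
    simp
    omega
  | succ n ih =>
    intro k b hs h1 h2
    obtain ⟨a, hab, ha, ho⟩ : ∃ a, b ≠ some a ∧ 1 ≤ k a ∧ ∀ i, i ≠ a → 2 * k i ≤ n + 1 := by
      by_cases hc : ∃ a, 2 * k a = n + 2
      · obtain ⟨a, ha⟩ := hc
        refine ⟨a, fun hb => ?_, by omega, fun i hi => ?_⟩
        · have := h2 a hb
          omega
        · have := Finset.add_le_sum (s := Finset.univ) (f := k) (fun _ _ => Nat.zero_le _)
            (Finset.mem_univ i) (Finset.mem_univ a) hi
          omega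
      · push Not at hc
        have hall : ∀ i, 2 * k i ≤ n + 1 := fun i => by
          have := h1 i
          have := hc i
          omega
        by_contra! hcon
        have hz : ∀ a, b ≠ some a → k a = 0 := by
          intro a hab
          by_contra hne
          obtain ⟨i, _, hi⟩ := hcon a hab (by omega)
          have := hall i
          omega
        cases b with
        | none =>
          have : ∑ i, k i = 0 := Finset.sum_eq_zero (fun i _ => hz i (by simp))
          omega
        | some j =>
          have : ∑ i, k i = k j := Finset.sum_eq_single j
            (fun i _ hi => hz i (by simpa using hi.symm)) (by simp)
          have := hall j
          omega
    have hsum : ∑ i, k i = ∑ i, (k i - if a = i then 1 else 0) + 1 := by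
      have h3 : ∀ i, k i = (k i - if a = i then 1 else 0) + (if a = i then 1 else 0) := by
        intro i
        split_ifs with h
        · subst h
          omega
        · omega
      rw [Finset.sum_congr rfl (fun i _ => h3 i), Finset.sum_add_distrib]
      simp
    obtain ⟨w, hw1, hw2, hw3⟩ := ih (fun i => k i - if a = i then 1 else 0) (some a)
      (by omega)
      (fun i => by
        have := h1 i
        by_cases h : a = i
        · simp only [h, if_true]
          omega
        · have := ho i (Ne.symm h)
          simp only [h, if_false]
          omega)
      (fun i hi => by
        have := h1 i
        have hi' : a = i := by simpa using hi
        simp only [hi', if_true]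
        omega)
    refine ⟨a :: w, ?_, fun i => ?_, fun i hi => ?_⟩
    · rw [List.isChain_cons]
      refine ⟨fun y hy hay => hw3 a rfl ?_, hw1⟩
      subst hay
      exact hy
    · rw [List.count_cons, hw2]
      by_cases h : a = i
      · subst h
        simp
        omega
      · simp [h]
    · intro hh
      simp at hh
      subst hh
      exact hab hi

/-- The number of Smirnov words with letter counts
`k_1, …, k_p` is positive if and only if
`2 · max{k_1, …, k_p} ≤ 1 + (k_1 + … + k_p)`. -/
theorem smirnovCount_pos_iff (p : ℕ) (k : Fin p → ℕ) :
    0 < smirnovCount k ↔ 2 * Finset.univ.sup k ≤ 1 + ∑ i, k i := by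
  have hfin : Finite {w : List (Fin p) //
      List.IsChain (· ≠ ·) w ∧ ∀ i : Fin p, w.count i = k i} := by
    apply Set.Finite.to_subtype
    apply (List.finite_length_eq (Fin p) (∑ i, k i)).subset
    rintro w ⟨_, hw⟩
    simp [smirnov_length, hw]
  have key : 0 < smirnovCount k ↔ ∃ w : List (Fin p),
      List.IsChain (· ≠ ·) w ∧ ∀ i : Fin p, w.count i = k i := by
    unfold smirnovCount
    rw [Nat.card_pos_iff]
    exact ⟨fun h => nonempty_subtype.1 h.1, fun h => ⟨nonempty_subtype.2 h, hfin⟩⟩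
  rw [key]
  constructor
  · rintro ⟨w, hw, hc⟩
    have hl : w.length = ∑ i, k i := by simp [smirnov_length, hc]
    have : Finset.univ.sup k ≤ (1 + ∑ i, k i) / 2 := by
      apply Finset.sup_le
      intro i _
      have := smirnov_forward i w hw
      rw [hc, hl] at this
      split_ifs at this <;> omega
    omega
  · intro h
    obtain ⟨w, h1, h2, _⟩ := smirnov_backward _ k none rfl (fun i => by
      have := Finset.le_sup (f := k) (Finset.mem_univ i)
      omega) (by simp)
    exact ⟨w, h1, h2⟩
end
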